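/- Let n be a positive integer and g = g_0 ⊕ g_1 a classical Lie superalgebra such that there are finitely many simple modules of dimension ≤ n in F_(g,g_0). Then there are only finitely many isomorphism classes of endotrivial modules in F_(g,g_0) of dimension n. -/

import Mathlib

/-!
A concrete model of the setting of the paper "On Endotrivial Modules for Lie
Superalgebras":  Lie superalgebras `g = g₀ ⊕ g₁` over an algebraically closed
field `k` of characteristic `0`, and the category `F = F_(g,g₀)` of
finite-dimensional `ℤ₂`-graded `g`-supermodules which are completely reducible
over `g₀`.  All of the notions used in the paper (supermodule homomorphisms,
isomorphisms, direct sums, tensor products, duals, internal `Hom`, the trivial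
supermodules `k_ev` and `k_od`, the parity change functor `Π`, projectivity,
projective covers and injective hulls, the syzygy operators `Ωⁿ` for `n : ℤ`,
endotrivial supermodules, and the group `T(g)` of stable equivalence classes of
endotrivial supermodules) are defined concretely below.  Constructed objects
(direct sums, tensor products, duals, internal Hom, parity shifts) are
characterised by predicates expressing the usual explicit formulas.
-/

noncomputable section

namespace LieSup

open Submodule

/-- A Lie superalgebra `g = g₀ ⊕ g₁` over `k`: a `ℤ₂`-graded vector space
together with a bilinear bracket which respects the grading, is super
skew-symmetric and satisfies the super Jacobi identity (stated on the even and
odd components; the general identities follow by bilinearity). -/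
structure LieSuperAlg (k : Type) [Field k] : Type 1 where
  carrier : Type
  [isAddCommGroup : AddCommGroup carrier]
  [isModule : Module k carrier]
  /-- the even component `g₀` -/
  ev : Submodule k carrier
  /-- the odd component `g₁` -/
  od : Submodule k carrier
  isCompl : IsCompl ev od
  bracket : carrier →ₗ[k] carrier →ₗ[k] carrier
  bracket_ev_ev : ∀ x ∈ ev, ∀ y ∈ ev, bracket x y ∈ ev
  bracket_ev_od : ∀ x ∈ ev, ∀ y ∈ od, bracket x y ∈ od
  bracket_od_ev : ∀ x ∈ od, ∀ y ∈ ev, bracket x y ∈ od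
  bracket_od_od : ∀ x ∈ od, ∀ y ∈ od, bracket x y ∈ ev
  super_skew_ev : ∀ x ∈ ev, ∀ y, bracket x y = - bracket y x
  super_skew_od : ∀ x ∈ od, ∀ y ∈ od, bracket x y = bracket y x
  super_jacobi_ev : ∀ x ∈ ev, ∀ y z, bracket x (bracket y z)
      = bracket (bracket x y) z + bracket y (bracket x z)
  super_jacobi_od_ev : ∀ x ∈ od, ∀ y ∈ ev, ∀ z, bracket x (bracket y z)
      = bracket (bracket x y) z + bracket y (bracket x z)
  super_jacobi_od_od : ∀ x ∈ od, ∀ y ∈ od, ∀ z, bracket x (bracket y z)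
      = bracket (bracket x y) z - bracket y (bracket x z)

attribute [instance] LieSuperAlg.isAddCommGroup LieSuperAlg.isModule

variable {k : Type} [Field k]

/-- An object of the category `F = F_(g,g₀)`: a finite-dimensional
`ℤ₂`-graded `g`-supermodule which is completely reducible over `g₀`.
The super-action axiom `ρ[x,y] = ρx ρy - (-1)^{|x||y|} ρy ρx` is stated on
homogeneous components and extends by bilinearity. -/
structure SupMod (g : LieSuperAlg k) : Type 1 where
  carrier : Type
  [isAddCommGroup : AddCommGroup carrier]
  [isModule : Module k carrier]
  [isFinite : FiniteDimensional k carrier]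
  /-- the even component `M₀` -/
  ev : Submodule k carrier
  /-- the odd component `M₁` -/
  od : Submodule k carrier
  isCompl : IsCompl ev od
  /-- the action of `g` -/
  ρ : g.carrier →ₗ[k] carrier →ₗ[k] carrier
  ρ_ev_ev : ∀ x ∈ g.ev, ∀ m ∈ ev, ρ x m ∈ ev
  ρ_ev_od : ∀ x ∈ g.ev, ∀ m ∈ od, ρ x m ∈ od
  ρ_od_ev : ∀ x ∈ g.od, ∀ m ∈ ev, ρ x m ∈ od
  ρ_od_od : ∀ x ∈ g.od, ∀ m ∈ od, ρ x m ∈ ev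
  ρ_bracket_ev : ∀ x ∈ g.ev, ∀ y, ρ (g.bracket x y) = ρ x ∘ₗ ρ y - ρ y ∘ₗ ρ x
  ρ_bracket_od : ∀ x ∈ g.od, ∀ y ∈ g.od, ρ (g.bracket x y) = ρ x ∘ₗ ρ y + ρ y ∘ₗ ρ x
  /-- complete reducibility over `g₀`: every `g₀`-submodule has a
  `g₀`-invariant complement -/
  completelyReducible : ∀ N : Submodule k carrier,
    (∀ x ∈ g.ev, ∀ m ∈ N, ρ x m ∈ N) →
    ∃ N' : Submodule k carrier, (∀ x ∈ g.ev, ∀ m ∈ N', ρ x m ∈ N') ∧ IsCompl N N'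

attribute [instance] SupMod.isAddCommGroup SupMod.isModule SupMod.isFinite

/-- The projection of `g` onto its even component along the odd one. -/
def LieSuperAlg.pEv (g : LieSuperAlg k) : g.carrier →ₗ[k] g.carrier :=
  g.ev.subtype ∘ₗ Submodule.linearProjOfIsCompl g.ev g.od g.isCompl

/-- The projection of `g` onto its odd component along the even one. -/
def LieSuperAlg.pOd (g : LieSuperAlg k) : g.carrier →ₗ[k] g.carrier :=
  g.od.subtype ∘ₗ Submodule.linearProjOfIsCompl g.od g.ev g.isCompl.symm

namespace SupMod

variable {g : LieSuperAlg k}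

/-- The grading involution `σ` of a supermodule: `+1` on the even part and
`-1` on the odd part.  For a homogeneous `f` of degree `|f|` one has
`σ_N ∘ f ∘ σ_M = (-1)^{|f|} f`, which is used to express the sign conventions
of the super category. -/
def sigma (M : SupMod g) : M.carrier →ₗ[k] M.carrier :=
  M.ev.subtype ∘ₗ Submodule.linearProjOfIsCompl M.ev M.od M.isCompl
    - M.od.subtype ∘ₗ Submodule.linearProjOfIsCompl M.od M.ev M.isCompl.symm

/-- `f` is a homomorphism of supermodules (a `g`-equivariant linear map of
degree `0̄`). -/
def IsHom (M N : SupMod g) (f : M.carrier →ₗ[k] N.carrier) : Prop :=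
  (∀ x : g.carrier, f ∘ₗ M.ρ x = N.ρ x ∘ₗ f) ∧
  (∀ m ∈ M.ev, f m ∈ N.ev) ∧ (∀ m ∈ M.od, f m ∈ N.od)

/-- `M ≅ N` as supermodules. -/
def Iso (M N : SupMod g) : Prop :=
  ∃ e : M.carrier ≃ₗ[k] N.carrier, IsHom M N (e : M.carrier →ₗ[k] N.carrier)

/-- `S` is (isomorphic to) the direct sum `A ⊕ B` of supermodules. -/
def IsDsum (A B S : SupMod g) : Prop :=
  ∃ φ : S.carrier ≃ₗ[k] A.carrier × B.carrier,
    (∀ s, s ∈ S.ev ↔ (φ s).1 ∈ A.ev ∧ (φ s).2 ∈ B.ev) ∧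
    (∀ s, s ∈ S.od ↔ (φ s).1 ∈ A.od ∧ (φ s).2 ∈ B.od) ∧
    ∀ (x : g.carrier) (s : S.carrier),
      φ (S.ρ x s) = LinearMap.prodMap (A.ρ x) (B.ρ x) (φ s)

/-- `M'` is (isomorphic to) the parity shift `Π(M)`: the same underlying
`g`-action with the `ℤ₂`-grading interchanged. -/
def IsPShift (M M' : SupMod g) : Prop :=
  ∃ φ : M.carrier ≃ₗ[k] M'.carrier,
    (∀ m, m ∈ M.ev ↔ φ m ∈ M'.od) ∧
    (∀ m, m ∈ M.od ↔ φ m ∈ M'.ev) ∧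
    ∀ (x : g.carrier) (m : M.carrier), φ (M.ρ x m) = M'.ρ x (φ m)

/-- `M` is (isomorphic to) the trivial supermodule of parity `p`: `k_ev` for
`p = false` and `k_od = Π(k_ev)` for `p = true`. -/
def IsTrivial (p : Bool) (M : SupMod g) : Prop :=
  Module.finrank k M.carrier = 1 ∧ M.ρ = 0 ∧
    (if p then M.od = ⊤ else M.ev = ⊤)

/-- `P` is a projective object of `F` (defined by the lifting property). -/
def IsProjective (P : SupMod g) : Prop :=
  ∀ (M N : SupMod g) (π : M.carrier →ₗ[k] N.carrier) (f : P.carrier →ₗ[k] N.carrier),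
    IsHom M N π → Function.Surjective π → IsHom P N f →
    ∃ h : P.carrier →ₗ[k] M.carrier, IsHom P M h ∧ π ∘ₗ h = f

/-- `I` is an injective object of `F` (defined by the extension property). -/
def IsInjective (I : SupMod g) : Prop :=
  ∀ (M N : SupMod g) (j : M.carrier →ₗ[k] N.carrier) (f : M.carrier →ₗ[k] I.carrier),
    IsHom M N j → Function.Injective j → IsHom M I f →
    ∃ h : N.carrier →ₗ[k] I.carrier, IsHom N I h ∧ h ∘ₗ j = f

/-- `π : P ↠ M` is a projective cover: `P` is projective, `π` is surjective
and the kernel of `π` is superfluous. -/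
def IsProjCover (P M : SupMod g) (π : P.carrier →ₗ[k] M.carrier) : Prop :=
  IsProjective P ∧ IsHom P M π ∧ Function.Surjective π ∧
  ∀ (Q : SupMod g) (f : Q.carrier →ₗ[k] P.carrier),
    IsHom Q P f → Function.Surjective (π ∘ₗ f) → Function.Surjective f

/-- `j : M ↪ I` is an injective hull: `I` is injective, `j` is injective
and the image of `j` is essential. -/
def IsInjHull (M I : SupMod g) (j : M.carrier →ₗ[k] I.carrier) : Prop :=
  IsInjective I ∧ IsHom M I j ∧ Function.Injective j ∧
  ∀ (Q : SupMod g) (f : I.carrier →ₗ[k] Q.carrier),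
    IsHom I Q f → Function.Injective (f ∘ₗ j) → Function.Injective f

/-- `N` is (isomorphic to) the first syzygy `Ω¹(M)`, the kernel of a
projective cover of `M`. -/
def IsSyzygy (M N : SupMod g) : Prop :=
  ∃ (P : SupMod g) (π : P.carrier →ₗ[k] M.carrier) (i : N.carrier →ₗ[k] P.carrier),
    IsProjCover P M π ∧ IsHom N P i ∧ Function.Injective i ∧
    LinearMap.range i = LinearMap.ker π

/-- `N` is (isomorphic to) the first cosyzygy `Ω⁻¹(M)`, the cokernel of the
inclusion of `M` into its injective hull. -/
def IsCosyzygy (M N : SupMod g) : Prop :=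
  ∃ (I : SupMod g) (j : M.carrier →ₗ[k] I.carrier) (p : I.carrier →ₗ[k] N.carrier),
    IsInjHull M I j ∧ IsHom I N p ∧ Function.Surjective p ∧
    LinearMap.ker p = LinearMap.range j

/-- `M` has no nonzero projective direct summand. -/
def NoProjSummands (M : SupMod g) : Prop :=
  ∀ A B : SupMod g, IsProjective A → IsDsum A B M → ∀ a : A.carrier, a = 0

/-- `N` is (isomorphic to) `Ω⁰(M)`, the complement of the largest projective
direct summand of `M`. -/
def IsOmegaZero (M N : SupMod g) : Prop :=
  ∃ Q : SupMod g, IsProjective Q ∧ NoProjSummands N ∧ IsDsum N Q M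

/-- `N` is (isomorphic to) `Ωⁿ(M)` for `n ∈ ℕ`. -/
def IsOmegaPow : ℕ → SupMod g → SupMod g → Prop
  | 0, M, N => IsOmegaZero M N
  | n+1, M, N => ∃ L, IsOmegaPow n M L ∧ IsSyzygy L N

/-- `N` is (isomorphic to) `Ω⁻ⁿ(M)` for `n ∈ ℕ`. -/
def IsOmegaNegPow : ℕ → SupMod g → SupMod g → Prop
  | 0, M, N => IsOmegaZero M N
  | n+1, M, N => ∃ L, IsOmegaNegPow n M L ∧ IsCosyzygy L N

/-- `N` is (isomorphic to) the syzygy `Ωⁿ(M)`, for any `n : ℤ`. -/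
def IsOmega (n : ℤ) (M N : SupMod g) : Prop :=
  if 0 ≤ n then IsOmegaPow n.toNat M N else IsOmegaNegPow (-n).toNat M N

/-- `H` is (isomorphic to) the internal Hom supermodule `Hom_k(M,N)`, with the
usual grading and the super action
`(x·f)(m) = x·f(m) - (-1)^{|x||f|} f(x·m)` (expressed below via the grading
involutions `σ` and the even/odd projections of `g`). -/
def IsHomObj (M N H : SupMod g) : Prop :=
  ∃ φ : H.carrier ≃ₗ[k] (M.carrier →ₗ[k] N.carrier),
    (∀ h, h ∈ H.ev ↔ ((∀ m ∈ M.ev, φ h m ∈ N.ev) ∧ (∀ m ∈ M.od, φ h m ∈ N.od))) ∧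
    (∀ h, h ∈ H.od ↔ ((∀ m ∈ M.ev, φ h m ∈ N.od) ∧ (∀ m ∈ M.od, φ h m ∈ N.ev))) ∧
    ∀ (x : g.carrier) (h : H.carrier),
      φ (H.ρ x h)
        = N.ρ x ∘ₗ φ h - φ h ∘ₗ M.ρ (g.pEv x)
          - (N.sigma ∘ₗ φ h ∘ₗ M.sigma) ∘ₗ M.ρ (g.pOd x)

/-- `T` is (isomorphic to) the tensor product supermodule `M ⊗_k N`, with the
usual grading and the super action
`x·(m ⊗ n) = (x·m) ⊗ n + (-1)^{|x||m|} m ⊗ (x·n)`. -/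
def IsTensorObj (M N T : SupMod g) : Prop :=
  ∃ φ : T.carrier ≃ₗ[k] TensorProduct k M.carrier N.carrier,
    Submodule.map (φ : T.carrier →ₗ[k] TensorProduct k M.carrier N.carrier) T.ev
      = Submodule.span k
          ({z | ∃ m ∈ M.ev, ∃ n ∈ N.ev, z = m ⊗ₜ[k] n}
            ∪ {z | ∃ m ∈ M.od, ∃ n ∈ N.od, z = m ⊗ₜ[k] n}) ∧
    Submodule.map (φ : T.carrier →ₗ[k] TensorProduct k M.carrier N.carrier) T.od
      = Submodule.span k
          ({z | ∃ m ∈ M.ev, ∃ n ∈ N.od, z = m ⊗ₜ[k] n}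
            ∪ {z | ∃ m ∈ M.od, ∃ n ∈ N.ev, z = m ⊗ₜ[k] n}) ∧
    ∀ (x : g.carrier) (t : T.carrier),
      φ (T.ρ x t)
        = TensorProduct.map (M.ρ x) (LinearMap.id : N.carrier →ₗ[k] N.carrier) (φ t)
            + TensorProduct.map (LinearMap.id : M.carrier →ₗ[k] M.carrier) (N.ρ (g.pEv x)) (φ t)
            + TensorProduct.map M.sigma (N.ρ (g.pOd x)) (φ t)

/-- `D` is (isomorphic to) the dual supermodule `M* = Hom_k(M, k_ev)`, with
the action `(x·ψ)(m) = -(-1)^{|x||ψ|} ψ(x·m)`. -/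
def IsDualObj (M D : SupMod g) : Prop :=
  ∃ φ : D.carrier ≃ₗ[k] Module.Dual k M.carrier,
    (∀ d, d ∈ D.ev ↔ ∀ m ∈ M.od, φ d m = 0) ∧
    (∀ d, d ∈ D.od ↔ ∀ m ∈ M.ev, φ d m = 0) ∧
    ∀ (x : g.carrier) (d : D.carrier),
      φ (D.ρ x d) = - (φ d) ∘ₗ (M.ρ (g.pEv x) + M.sigma ∘ₗ M.ρ (g.pOd x))

/-- `M` is an endotrivial supermodule:
`Hom_k(M,M) ≅ k_ev ⊕ P` with `P` projective in `F`. -/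
def IsEndotrivial (M : SupMod g) : Prop :=
  ∃ H K P S : SupMod g, IsHomObj M M H ∧ IsTrivial false K ∧
    IsProjective P ∧ IsDsum K P S ∧ Iso H S

/-- `M` and `N` are isomorphic in the stable module category of `F`, i.e.
they become isomorphic after adding projective direct summands. -/
def StIso (M N : SupMod g) : Prop :=
  ∃ P Q S T : SupMod g, IsProjective P ∧ IsProjective Q ∧
    IsDsum M P S ∧ IsDsum N Q T ∧ Iso S T

/-- `M` is a simple supermodule: it is nonzero and has no proper nonzero
graded `g`-submodule. -/
def IsSimple (M : SupMod g) : Prop :=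
  (∃ m : M.carrier, m ≠ 0) ∧
  ∀ N : Submodule k M.carrier,
    (∀ (x : g.carrier), ∀ m ∈ N, M.ρ x m ∈ N) →
    N = (N ⊓ M.ev) ⊔ (N ⊓ M.od) →
    N = ⊥ ∨ N = ⊤

end SupMod

open SupMod

/-- The relation on endotrivial supermodules inducing the group `T(g)`:
stable isomorphism. -/
def TRel (g : LieSuperAlg k) :
    {M : SupMod g // IsEndotrivial M} → {M : SupMod g // IsEndotrivial M} → Prop :=
  fun M N => StIso M.1 N.1

/-- The underlying set of the group `T(g)`: stable isomorphism classes of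
endotrivial supermodules in `F`. -/
def TGrp (g : LieSuperAlg k) : Type 1 := Quot (TRel g)

/-- The stable class of an endotrivial supermodule in `T(g)`. -/
def tmk (g : LieSuperAlg k) (M : {M : SupMod g // IsEndotrivial M}) : TGrp g :=
  Quot.mk (TRel g) M

/-- An abelian group structure on `T(g)` whose multiplication, identity and
inverse are induced by tensor product, the trivial module `k_ev` and duality
respectively. -/
structure TGroupData (g : LieSuperAlg k) : Type 1 where
  mul : TGrp g → TGrp g → TGrp g
  one : TGrp g
  inv : TGrp g → TGrp g
  mul_assoc : ∀ a b c, mul (mul a b) c = mul a (mul b c)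
  mul_comm : ∀ a b, mul a b = mul b a
  one_mul : ∀ a, mul one a = a
  inv_mul : ∀ a, mul (inv a) a = one
  mul_spec : ∀ (M N : {M : SupMod g // IsEndotrivial M}) (T : SupMod g)
      (_ : IsTensorObj M.1 N.1 T) (hT : IsEndotrivial T),
      mul (tmk g M) (tmk g N) = tmk g ⟨T, hT⟩
  one_spec : ∀ (K : SupMod g) (_ : IsTrivial false K) (hK : IsEndotrivial K),
      one = tmk g ⟨K, hK⟩
  inv_spec : ∀ (M : {M : SupMod g // IsEndotrivial M}) (D : SupMod g)
      (_ : IsDualObj M.1 D) (hD : IsEndotrivial D),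
      inv (tmk g M) = tmk g ⟨D, hD⟩

end LieSup

namespace LieSup

variable {k : Type} [Field k]

/-- `g` is a classical Lie superalgebra.  (In the paper: there is a connected
reductive algebraic group `G₀` with Lie algebra `g₀` such that the action of
`g₀` on `g₁` differentiates a `G₀`-action.  Over an algebraically closed field
of characteristic zero we formalize the representation-theoretic content of
this: `g` is finite dimensional and completely reducible as a `g₀`-module
under the adjoint action — in particular `g₀` is a reductive Lie algebra.) -/
def LieSuperAlg.IsClassical (g : LieSuperAlg k) : Prop :=
  FiniteDimensional k g.carrier ∧
  ∀ N : Submodule k g.carrier,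
    (∀ x ∈ g.ev, ∀ y ∈ N, g.bracket x y ∈ N) →
    ∃ N' : Submodule k g.carrier,
      (∀ x ∈ g.ev, ∀ y ∈ N', g.bracket x y ∈ N') ∧ IsCompl N N'

end LieSup

namespace LieSup

section Poly

universe u
variable {X : Type u} {F : Type} [Field F]
variable {V V' V'' : Type} [AddCommGroup V] [Module F V]
  [AddCommGroup V'] [Module F V'] [AddCommGroup V''] [Module F V'']

/-- A vector valued map all of whose coordinates lie in the algebra `A` of functions. -/
def IsPolyMap (A : Subalgebra F (X → F)) (f : X → V) : Prop :=
  ∀ μ : Module.Dual F V, (fun x => μ (f x)) ∈ A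

/-- A family of linear maps with coefficients in `A`. -/
def IsPolyFam (A : Subalgebra F (X → F)) (T : X → (V →ₗ[F] V')) : Prop :=
  ∀ v, IsPolyMap A (fun x => T x v)

theorem IsPolyMap.add {A : Subalgebra F (X → F)} {f g : X → V} (hf : IsPolyMap A f)
    (hg : IsPolyMap A g) : IsPolyMap A (fun x => f x + g x) := by
  intro μ
  have := A.add_mem (hf μ) (hg μ)
  convert this using 1
  ext x
  simp

theorem IsPolyMap.const (A : Subalgebra F (X → F)) (v : V) : IsPolyMap A (fun _ : X => v) := by
  intro μ
  exact A.algebraMap_mem (μ v)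

theorem IsPolyMap.comp {A : Subalgebra F (X → F)} {f : X → V} (hf : IsPolyMap A f)
    (T : V →ₗ[F] V') : IsPolyMap A (fun x => T (f x)) :=
  fun μ => hf (μ ∘ₗ T)

theorem matrix_det_mem (A : Subalgebra F (X → F)) {m : Type} [Fintype m] [DecidableEq m]
    (M : X → Matrix m m F) (h : ∀ i j, (fun x => M x i j) ∈ A) :
    (fun x => (M x).det) ∈ A := by
  have : (fun x => (M x).det) = ∑ σ : Equiv.Perm m,
      ((Equiv.Perm.sign σ : ℤ) : X → F) * ∏ i, (fun x => M x (σ i) i) := by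
    ext x
    simp [Matrix.det_apply', Finset.sum_apply, Finset.prod_apply]
  rw [this]
  refine A.sum_mem fun σ _ => A.mul_mem (A.intCast_mem _) (A.prod_mem fun i _ => h _ _)

theorem IsPolyFam.det_mem [FiniteDimensional F V] {A : Subalgebra F (X → F)}
    {T : X → (V →ₗ[F] V)} (h : IsPolyFam A T) :
    (fun x => LinearMap.det (T x)) ∈ A := by
  let b := Module.finBasis F V
  have : (fun x => LinearMap.det (T x)) = fun x => (LinearMap.toMatrix b b (T x)).det := by
    ext x
    rw [LinearMap.det_toMatrix]
  rw [this]
  apply matrix_det_mem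
  intro i j
  have := h (b j) (b.coord i)
  simpa [LinearMap.toMatrix_apply] using this

theorem IsPolyFam.adj [FiniteDimensional F V] {A : Subalgebra F (X → F)}
    {T : X → (V →ₗ[F] V)} (h : IsPolyFam A T) (e : V) :
    ∃ v : X → V, IsPolyMap A v ∧ (∀ x, T x (v x) = LinearMap.det (T x) • e) ∧
      ∀ x, T x = LinearMap.id → v x = e := by
  let b := Module.finBasis F V
  let M : X → Matrix _ _ F := fun x => LinearMap.toMatrix b b (T x)
  have hM : ∀ i j, (fun x => M x i j) ∈ A := by
    intro i j
    have := h (b j) (b.coord i)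
    simpa [M, LinearMap.toMatrix_apply] using this
  refine ⟨fun x => Matrix.toLin b b (M x).adjugate e, ?_, ?_, ?_⟩
  · intro μ
    have key : (fun x => μ (Matrix.toLin b b (M x).adjugate e)) =
        ∑ i, ∑ j, (algebraMap F (X → F) (μ (b i) * b.repr e j)) *
          (fun x => (M x).adjugate i j) := by
      ext x
      simp only [Matrix.toLin_apply, map_sum, map_smul, Finset.sum_apply, Pi.mul_apply,
        Pi.algebraMap_apply, Matrix.mulVec, dotProduct, smul_eq_mul, Finset.sum_mul]
      refine Finset.sum_congr rfl fun i _ => Finset.sum_congr rfl fun j _ => ?_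
      simp
      ring
    rw [key]
    refine A.sum_mem fun i _ => A.sum_mem fun j _ => A.mul_mem (A.algebraMap_mem _) ?_
    simp only [Matrix.adjugate_apply]
    apply matrix_det_mem
    intro i' j'
    by_cases hj : i' = j
    · subst hj
      simp only [Matrix.updateRow_self]
      exact A.algebraMap_mem ((Pi.single i (1 : F) : Fin _ → F) j')
    · simp only [Matrix.updateRow_ne hj]
      exact hM _ _
  · intro x
    have h1 : T x = Matrix.toLin b b (M x) := by simp [M]
    have h2 : (Matrix.toLin b b (M x)) ∘ₗ (Matrix.toLin b b (M x).adjugate)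
        = LinearMap.det (T x) • LinearMap.id := by
      rw [← Matrix.toLin_mul, Matrix.mul_adjugate, map_smul, Matrix.toLin_one,
        ← LinearMap.det_toMatrix b]
    have h3 := LinearMap.congr_fun h2 e
    conv_lhs => rw [h1]
    simpa using h3
  · intro x hx
    have : M x = 1 := by simp [M, hx]
    simp [this]

/-- Deformation of cocycles: if the complex is exact at `x₀`, then elements of the kernel at `x₀`
deform to the kernel at nearby points. -/
theorem deform [FiniteDimensional F V] [FiniteDimensional F V']
    (A : Subalgebra F (X → F))
    (d0 : X → (V →ₗ[F] V')) (d1 : X → (V' →ₗ[F] V''))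
    (h0 : IsPolyFam A d0) (h1 : IsPolyFam A d1)
    (hd : ∀ x v, d1 x (d0 x v) = 0) (x₀ : X)
    (hex : ∀ c, d1 x₀ c = 0 → ∃ f, d0 x₀ f = c) (e : V) (he : d0 x₀ e = 0) :
    ∃ (h : X → F) (v : X → V), h ∈ A ∧ IsPolyMap A v ∧ h x₀ ≠ 0 ∧ v x₀ = e ∧
      ∀ x, h x ≠ 0 → d0 x (v x) = 0 := by
  obtain ⟨s₀, hs₀⟩ : ∃ s : V' →ₗ[F] V, ∀ v, d0 x₀ (s (d0 x₀ v)) = d0 x₀ v := by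
    obtain ⟨r, hr⟩ := (d0 x₀).rangeRestrict.exists_rightInverse_of_surjective
      (LinearMap.range_rangeRestrict _)
    obtain ⟨s, hs⟩ := LinearMap.exists_extend r
    refine ⟨s, fun v => ?_⟩
    have e1 : s (d0 x₀ v) = r ((d0 x₀).rangeRestrict v) := by
      rw [← hs]; rfl
    rw [e1]
    have := LinearMap.congr_fun hr ((d0 x₀).rangeRestrict v)
    simpa using congrArg Subtype.val this
  let s : V' →ₗ[F] V := s₀ ∘ₗ d0 x₀ ∘ₗ s₀
  have hs1 : ∀ v, d0 x₀ (s (d0 x₀ v)) = d0 x₀ v := by intro v; simp [s, hs₀]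
  have hs2 : ∀ c, s (d0 x₀ (s c)) = s c := by intro v; simp [s, hs₀]
  obtain ⟨t, ht⟩ : ∃ t : V'' →ₗ[F] V', ∀ c, t (d1 x₀ c) = c - d0 x₀ (s c) := by
    let q : V' →ₗ[F] V' := LinearMap.id - d0 x₀ ∘ₗ s
    have hq : LinearMap.ker (d1 x₀) ≤ LinearMap.ker q := by
      intro c hc
      obtain ⟨f, rfl⟩ := hex c hc
      simp [q, hs1]
    obtain ⟨r, hr⟩ := (d1 x₀).rangeRestrict.exists_rightInverse_of_surjective
      (LinearMap.range_rangeRestrict _)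
    obtain ⟨t, ht⟩ := LinearMap.exists_extend (q ∘ₗ r)
    refine ⟨t, fun c => ?_⟩
    have e1 : t (d1 x₀ c) = q (r ((d1 x₀).rangeRestrict c)) := by
      rw [← LinearMap.comp_apply q r, ← ht]; rfl
    rw [e1]
    have e2 : r ((d1 x₀).rangeRestrict c) - c ∈ LinearMap.ker (d1 x₀) := by
      have := LinearMap.congr_fun hr ((d1 x₀).rangeRestrict c)
      have := congrArg Subtype.val this
      simp only [LinearMap.mem_ker, map_sub, sub_eq_zero]
      simpa using this
    have e3 := hq e2
    rw [LinearMap.mem_ker, map_sub, sub_eq_zero] at e3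
    rw [e3]
    simp [q]
  let B : X → (V' →ₗ[F] V') := fun x => d0 x ∘ₗ s + t ∘ₗ d1 x
  have hB : IsPolyFam A B := by
    intro c
    exact (h0 (s c)).add ((h1 c).comp t)
  have hB0 : B x₀ = LinearMap.id := by
    ext c
    simp [B, ht]
  let D : X → (V →ₗ[F] V) := fun x => s ∘ₗ d0 x + (LinearMap.id - s ∘ₗ d0 x₀)
  have hD : IsPolyFam A D := by
    intro c
    exact ((h0 c).comp s).add (IsPolyMap.const A _)
  have hD0 : D x₀ = LinearMap.id := by
    simp [D]
  obtain ⟨v, hv, hv1, hv2⟩ := hD.adj e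
  refine ⟨fun x => LinearMap.det (B x), v, hB.det_mem, hv, ?_, hv2 _ hD0, ?_⟩
  · simp [hB0]
  · intro x hx
    have a1 := hv1 x
    have a2 : s (d0 x (v x)) = 0 := by
      have := congrArg (fun w => s (d0 x₀ w)) a1
      simpa [D, hs2, he] using this
    have a3 : B x (d0 x (v x)) = 0 := by simp [B, a2, hd]
    have a4 : IsUnit (LinearMap.det (B x)) := isUnit_iff_ne_zero.mpr hx
    have a5 := (LinearEquiv.ofIsUnitDet (f := B x) (v := Module.finBasis F V')
      (v' := Module.finBasis F V') (by simpa using a4)).injective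
    apply a5
    simpa using a3

end Poly

end LieSup

set_option linter.deprecated false

noncomputable section

namespace LieSup

variable {k : Type} [Field k]

namespace SupMod

variable {g : LieSuperAlg k}



/-- projection to the even part -/
def pe (M : SupMod g) : M.carrier →ₗ[k] M.carrier :=
  M.ev.subtype ∘ₗ Submodule.projectionOnto M.ev M.od M.isCompl

/-- projection to the odd part -/
def po (M : SupMod g) : M.carrier →ₗ[k] M.carrier :=
  M.od.subtype ∘ₗ Submodule.projectionOnto M.od M.ev M.isCompl.symm

theorem pe_mem (M : SupMod g) (m : M.carrier) : M.pe m ∈ M.ev := by simp [pe]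
theorem po_mem (M : SupMod g) (m : M.carrier) : M.po m ∈ M.od := by simp [po]

theorem pe_ev (M : SupMod g) {m : M.carrier} (h : m ∈ M.ev) : M.pe m = m := by
  have := Submodule.projectionOnto_apply_left M.isCompl ⟨m, h⟩
  exact congrArg Subtype.val this

theorem po_od (M : SupMod g) {m : M.carrier} (h : m ∈ M.od) : M.po m = m := by
  have := Submodule.projectionOnto_apply_left M.isCompl.symm ⟨m, h⟩
  exact congrArg Subtype.val this

theorem pe_od (M : SupMod g) {m : M.carrier} (h : m ∈ M.od) : M.pe m = 0 := by
  simpa [pe] using h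

theorem po_ev (M : SupMod g) {m : M.carrier} (h : m ∈ M.ev) : M.po m = 0 := by
  simpa [po] using h

theorem exists_parts (M : SupMod g) (m : M.carrier) :
    ∃ a ∈ M.ev, ∃ b ∈ M.od, m = a + b := by
  have : m ∈ M.ev ⊔ M.od := by rw [M.isCompl.sup_eq_top]; trivial
  obtain ⟨a, ha, b, hb, h⟩ := Submodule.mem_sup.mp this
  exact ⟨a, ha, b, hb, h.symm⟩

theorem pe_add_po (M : SupMod g) (m : M.carrier) : M.pe m + M.po m = m := by
  obtain ⟨a, ha, b, hb, rfl⟩ := M.exists_parts m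
  simp [pe_ev M ha, pe_od M hb, po_ev M ha, po_od M hb]

theorem eq_zero_of_ev_od (M : SupMod g) {m : M.carrier} (h : m ∈ M.ev) (h' : m ∈ M.od) :
    m = 0 := by
  rw [← M.pe_ev h, M.pe_od h']

theorem mem_ev_iff (M : SupMod g) {m : M.carrier} : m ∈ M.ev ↔ M.pe m = m :=
  ⟨M.pe_ev, fun h => h ▸ M.pe_mem m⟩

theorem sigma_apply (M : SupMod g) (m : M.carrier) : M.sigma m = M.pe m - M.po m := rfl

theorem sigma_ev (M : SupMod g) {m : M.carrier} (h : m ∈ M.ev) : M.sigma m = m := by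
  rw [sigma_apply, pe_ev M h, po_ev M h, sub_zero]

theorem sigma_od (M : SupMod g) {m : M.carrier} (h : m ∈ M.od) : M.sigma m = -m := by
  rw [sigma_apply, pe_od M h, po_od M h, zero_sub]

theorem sigma_mul_sigma (M : SupMod g) : (M.sigma * M.sigma : Module.End k M.carrier) = 1 := by
  ext m
  obtain ⟨a, ha, b, hb, rfl⟩ := M.exists_parts m
  simp [sigma_ev M ha, sigma_od M hb]

theorem sigma_even (M : SupMod g) {f : M.carrier →ₗ[k] M.carrier}
    (h0 : ∀ m ∈ M.ev, f m ∈ M.ev) (h1 : ∀ m ∈ M.od, f m ∈ M.od) :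
    (M.sigma * f : Module.End k M.carrier) = f * M.sigma := by
  ext m
  obtain ⟨a, ha, b, hb, rfl⟩ := M.exists_parts m
  simp [sigma_ev M ha, sigma_od M hb, sigma_ev M (h0 a ha), sigma_od M (h1 b hb)]

theorem sigma_odd (M : SupMod g) {f : M.carrier →ₗ[k] M.carrier}
    (h0 : ∀ m ∈ M.ev, f m ∈ M.od) (h1 : ∀ m ∈ M.od, f m ∈ M.ev) :
    (M.sigma * f : Module.End k M.carrier) = - (f * M.sigma) := by
  ext m
  obtain ⟨a, ha, b, hb, rfl⟩ := M.exists_parts m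
  simp [sigma_ev M ha, sigma_od M hb, sigma_od M (h0 a ha), sigma_ev M (h1 b hb), add_comm]

/-- the trace of an odd endomorphism vanishes -/
theorem trace_sigma_odd [CharZero k] (M : SupMod g) {f : M.carrier →ₗ[k] M.carrier}
    (h0 : ∀ m ∈ M.ev, f m ∈ M.od) (h1 : ∀ m ∈ M.od, f m ∈ M.ev) :
    LinearMap.trace k M.carrier (M.sigma * f : Module.End k M.carrier) = 0 := by
  have h := congrArg (LinearMap.trace k M.carrier) (M.sigma_odd h0 h1)
  rw [map_neg, LinearMap.trace_mul_comm k f] at h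
  exact self_eq_neg.mp h

end SupMod

theorem LieSuperAlg.pEv_ev (g : LieSuperAlg k) {x : g.carrier} (h : x ∈ g.ev) : g.pEv x = x := by
  have := Submodule.projectionOnto_apply_left g.isCompl ⟨x, h⟩
  exact congrArg Subtype.val this

theorem LieSuperAlg.pOd_od (g : LieSuperAlg k) {x : g.carrier} (h : x ∈ g.od) : g.pOd x = x := by
  have := Submodule.projectionOnto_apply_left g.isCompl.symm ⟨x, h⟩
  exact congrArg Subtype.val this

theorem LieSuperAlg.pEv_od (g : LieSuperAlg k) {x : g.carrier} (h : x ∈ g.od) : g.pEv x = 0 := by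
  show ((Submodule.projectionOnto g.ev g.od g.isCompl x : g.ev) : g.carrier) = 0
  simpa using h

theorem LieSuperAlg.pOd_ev (g : LieSuperAlg k) {x : g.carrier} (h : x ∈ g.ev) : g.pOd x = 0 := by
  show ((Submodule.projectionOnto g.od g.ev g.isCompl.symm x : g.od) : g.carrier) = 0
  simpa using h

theorem LieSuperAlg.exists_parts (g : LieSuperAlg k) (x : g.carrier) :
    ∃ a ∈ g.ev, ∃ b ∈ g.od, x = a + b := by
  have : x ∈ g.ev ⊔ g.od := by rw [g.isCompl.sup_eq_top]; trivial
  obtain ⟨a, ha, b, hb, h⟩ := Submodule.mem_sup.mp this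
  exact ⟨a, ha, b, hb, h.symm⟩

/-- nondegeneracy of the trace form -/
theorem trace_nondeg {k V : Type} [Field k] [AddCommGroup V] [Module k V] [FiniteDimensional k V]
    (f : Module.End k V) (h : ∀ u : Module.End k V, LinearMap.trace k V (f * u) = 0) : f = 0 := by
  ext v
  rw [LinearMap.zero_apply, ← Module.forall_dual_apply_eq_zero_iff k]
  intro μ
  have h1 := h (LinearMap.smulRight μ v)
  have h2 : f * LinearMap.smulRight μ v = LinearMap.smulRight μ (f v) := by
    ext w; simp
  rw [h2, LinearMap.trace_smulRight] at h1
  exact h1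

theorem trace_repr {k V : Type} [Field k] [AddCommGroup V] [Module k V] [FiniteDimensional k V]
    (l : Module.Dual k (Module.End k V)) :
    ∃ f : Module.End k V, ∀ u, l u = LinearMap.trace k V (f * u) := by
  let T : Module.End k V →ₗ[k] Module.Dual k (Module.End k V) :=
    (LinearMap.mul k (Module.End k V)).compr₂ (LinearMap.trace k V)
  have hT : Function.Injective T := by
    rw [injective_iff_map_eq_zero]
    intro f hf
    apply trace_nondeg
    intro u
    exact LinearMap.congr_fun hf u
  have hs := (LinearMap.injective_iff_surjective_of_finrank_eq_finrank
    (by rw [Subspace.dual_finrank_eq])).mp hT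
  obtain ⟨f, hf⟩ := hs l
  exact ⟨f, fun u => by rw [← hf]; rfl⟩

end LieSup

end

noncomputable section

namespace LieSup

section TraceId

variable {k V : Type} [Field k] [AddCommGroup V] [Module k V]

theorem tr_even (s R C u : Module.End k V) (h : s * R = R * s) :
    LinearMap.trace k V (s * ((R * C - C * R) * u))
      = - LinearMap.trace k V (s * (C * (R * u - u * R))) := by
  have e1 : LinearMap.trace k V (s * (R * C * u)) = LinearMap.trace k V (s * (C * (u * R))) := by
    have : s * (R * C * u) = R * (s * (C * u)) := by simp only [← mul_assoc, h]
    rw [this, LinearMap.trace_mul_comm]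
    simp only [mul_assoc]
  rw [sub_mul, mul_sub, map_sub, e1, mul_sub, mul_sub, map_sub]
  simp only [mul_assoc]
  ring

theorem tr_odd (s R C u : Module.End k V) (hs : s * s = 1) (h : s * C = - (C * s)) :
    LinearMap.trace k V (s * (C * (R * u - s * u * s * R)))
      = LinearMap.trace k V (s * ((C * R + R * C) * u)) := by
  have e1 : LinearMap.trace k V (s * (C * (s * u * s * R)))
      = - LinearMap.trace k V (s * (R * C * u)) := by
    have : s * (C * (s * u * s * R)) = - ((C * u) * (s * R)) := by
      calc s * (C * (s * u * s * R)) = (s * C) * (s * u * s * R) := by simp only [mul_assoc]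
        _ = - (C * (s * s) * u * (s * R)) := by rw [h]; simp only [mul_assoc, neg_mul]
        _ = _ := by rw [hs, mul_one]
    rw [this, map_neg, LinearMap.trace_mul_comm]
    simp only [mul_assoc]
  rw [mul_sub, mul_sub, map_sub, e1, add_mul, mul_add, map_add]
  simp only [mul_assoc]
  ring

theorem tr_odd' (s R C u : Module.End k V) (hs : s * s = 1) (h : s * C = C * s) :
    LinearMap.trace k V (s * (C * (R * u - s * u * s * R)))
      = LinearMap.trace k V (s * ((C * R - R * C) * u)) := by
  have e1 : LinearMap.trace k V (s * (C * (s * u * s * R)))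
      = LinearMap.trace k V (s * (R * C * u)) := by
    have : s * (C * (s * u * s * R)) = ((C * u) * (s * R)) := by
      calc s * (C * (s * u * s * R)) = (s * C) * (s * u * s * R) := by simp only [mul_assoc]
        _ = (C * (s * s) * u * (s * R)) := by rw [h]; simp only [mul_assoc]
        _ = _ := by rw [hs, mul_one]
    rw [this, LinearMap.trace_mul_comm]
    simp only [mul_assoc]
  rw [mul_sub, mul_sub, map_sub, e1, sub_mul, mul_sub, map_sub]
  simp only [mul_assoc]

end TraceId

namespace SupMod

variable {k : Type} [Field k] {g : LieSuperAlg k}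

/-- The data of an internal endomorphism object. -/
def IsEndVia (M H : SupMod g) (φ : H.carrier ≃ₗ[k] (M.carrier →ₗ[k] M.carrier)) : Prop :=
    (∀ h, h ∈ H.ev ↔ ((∀ m ∈ M.ev, φ h m ∈ M.ev) ∧ (∀ m ∈ M.od, φ h m ∈ M.od))) ∧
    (∀ h, h ∈ H.od ↔ ((∀ m ∈ M.ev, φ h m ∈ M.od) ∧ (∀ m ∈ M.od, φ h m ∈ M.ev))) ∧
    ∀ (x : g.carrier) (h : H.carrier),
      φ (H.ρ x h)
        = M.ρ x ∘ₗ φ h - φ h ∘ₗ M.ρ (g.pEv x)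
          - (M.sigma ∘ₗ φ h ∘ₗ M.sigma) ∘ₗ M.ρ (g.pOd x)

theorem IsEndVia.act_ev {M H : SupMod g} {φ : H.carrier ≃ₗ[k] (M.carrier →ₗ[k] M.carrier)}
    (h : IsEndVia M H φ) {x : g.carrier} (hx : x ∈ g.ev) (u : H.carrier) :
    (φ (H.ρ x u) : Module.End k M.carrier)
      = (M.ρ x : Module.End k M.carrier) * φ u - (φ u : Module.End k M.carrier) * M.ρ x := by
  rw [h.2.2, g.pEv_ev hx, g.pOd_ev hx]
  simp only [map_zero, LinearMap.comp_zero, sub_zero]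
  rfl

theorem IsEndVia.act_od {M H : SupMod g} {φ : H.carrier ≃ₗ[k] (M.carrier →ₗ[k] M.carrier)}
    (h : IsEndVia M H φ) {x : g.carrier} (hx : x ∈ g.od) (u : H.carrier) :
    (φ (H.ρ x u) : Module.End k M.carrier)
      = (M.ρ x : Module.End k M.carrier) * φ u
        - (M.sigma : Module.End k M.carrier) * φ u * M.sigma * M.ρ x := by
  rw [h.2.2, g.pEv_od hx, g.pOd_od hx]
  simp only [map_zero, LinearMap.comp_zero, sub_zero]
  rfl

/-- even, `g₀`-equivariant one-cochains with values in `End M` -/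
structure IsCochain (M : SupMod g) (c : g.carrier →ₗ[k] M.carrier →ₗ[k] M.carrier) : Prop where
  ev : ∀ x ∈ g.ev, c x = 0
  od_ev : ∀ x ∈ g.od, ∀ m ∈ M.ev, c x m ∈ M.od
  od_od : ∀ x ∈ g.od, ∀ m ∈ M.od, c x m ∈ M.ev
  equiv : ∀ x ∈ g.ev, ∀ y, c (g.bracket x y) = M.ρ x ∘ₗ c y - c y ∘ₗ M.ρ x

/-- one-cocycles -/
structure IsCocycle (M : SupMod g) (c : g.carrier →ₗ[k] M.carrier →ₗ[k] M.carrier) : Prop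
    extends IsCochain M c where
  coc : ∀ x ∈ g.od, ∀ y ∈ g.od, M.ρ x ∘ₗ c y + M.ρ y ∘ₗ c x + c x ∘ₗ M.ρ y + c y ∘ₗ M.ρ x = 0

/-- direct sums of completely reducible modules are completely reducible -/
theorem compl_prod {A B : Type} [AddCommGroup A] [Module k A] [AddCommGroup B] [Module k B]
    {ι : Type} (S : Set ι) (α : ι → A →ₗ[k] A) (β : ι → B →ₗ[k] B)
    (hA : ∀ N : Submodule k A, (∀ x ∈ S, ∀ m ∈ N, α x m ∈ N) →
      ∃ N' : Submodule k A, (∀ x ∈ S, ∀ m ∈ N', α x m ∈ N') ∧ IsCompl N N')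
    (hB : ∀ N : Submodule k B, (∀ x ∈ S, ∀ m ∈ N, β x m ∈ N) →
      ∃ N' : Submodule k B, (∀ x ∈ S, ∀ m ∈ N', β x m ∈ N') ∧ IsCompl N N')
    (N : Submodule k (A × B)) (hN : ∀ x ∈ S, ∀ m ∈ N, (α x m.1, β x m.2) ∈ N) :
    ∃ N' : Submodule k (A × B), (∀ x ∈ S, ∀ m ∈ N', (α x m.1, β x m.2) ∈ N') ∧
      IsCompl N N' := by
  obtain ⟨A', hA1, hA2⟩ := hA (N.comap (LinearMap.inl k A B)) (by
    intro x hx m hm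
    have := hN x hx _ hm
    simpa using this)
  obtain ⟨B', hB1, hB2⟩ := hB (N.map (LinearMap.snd k A B)) (by
    rintro x hx _ ⟨m, hm, rfl⟩
    exact ⟨_, hN x hx _ hm, rfl⟩)
  refine ⟨A'.prod B', ?_, ?_⟩
  · rintro x hx ⟨a, b⟩ ⟨ha, hb⟩
    exact ⟨hA1 x hx a ha, hB1 x hx b hb⟩
  · constructor
    · rw [Submodule.disjoint_def]
      rintro ⟨a, b⟩ hab ⟨ha, hb⟩
      have hb0 : b = 0 := (Submodule.disjoint_def.mp hB2.disjoint) b ⟨_, hab, rfl⟩ hb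
      subst hb0
      have ha0 : a = 0 := (Submodule.disjoint_def.mp hA2.disjoint) a hab ha
      subst ha0
      rfl
    · rw [codisjoint_iff, eq_top_iff]
      rintro ⟨a, b⟩ -
      have hb : b ∈ N.map (LinearMap.snd k A B) ⊔ B' := by rw [hB2.sup_eq_top]; trivial
      obtain ⟨_, ⟨⟨a2, n2⟩, hn, rfl⟩, b', hb', rfl⟩ := Submodule.mem_sup.mp hb
      have ha : a - a2 ∈ N.comap (LinearMap.inl k A B) ⊔ A' := by rw [hA2.sup_eq_top]; trivial
      obtain ⟨n1, hn1, a', ha', h⟩ := Submodule.mem_sup.mp ha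
      refine Submodule.mem_sup.mpr ⟨(a2, n2) + (n1, 0), N.add_mem hn hn1, (a', b'), ⟨ha', hb'⟩, ?_⟩
      have : a = a2 + (n1 + a') := by rw [h]; abel
      ext
      · simp [this, add_assoc]
      · simp

theorem compl_field (N : Submodule k k) : ∃ N' : Submodule k k, IsCompl N N' :=
  Submodule.exists_isCompl N

/-- The action on the extension of `H = End M` by the trivial module given by a cocycle. -/
def extRho (M H : SupMod g) (φ : H.carrier ≃ₗ[k] (M.carrier →ₗ[k] M.carrier))
    (c : g.carrier →ₗ[k] M.carrier →ₗ[k] M.carrier) :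
    g.carrier →ₗ[k] (k × H.carrier) →ₗ[k] (k × H.carrier) :=
  LinearMap.mk₂ k (fun x p =>
      (LinearMap.trace k M.carrier ((M.sigma : Module.End k M.carrier) * (c x * φ p.2)), H.ρ x p.2))
    (by intro x y p; ext <;> simp [add_mul, mul_add])
    (by intro a x p; ext <;> simp)
    (by intro x p q; ext <;> simp [mul_add])
    (by intro a x p; ext <;> simp)

theorem extRho_apply (M H : SupMod g) (φ : H.carrier ≃ₗ[k] (M.carrier →ₗ[k] M.carrier))
    (c : g.carrier →ₗ[k] M.carrier →ₗ[k] M.carrier) (x : g.carrier) (p : k × H.carrier) :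
    extRho M H φ c x p =
      (LinearMap.trace k M.carrier ((M.sigma : Module.End k M.carrier) * (c x * φ p.2)),
        H.ρ x p.2) := rfl

/-- the extension of `H = End M` by the even trivial module given by a cocycle -/
def extMod [CharZero k] (M H : SupMod g) (φ : H.carrier ≃ₗ[k] (M.carrier →ₗ[k] M.carrier))
    (hφ : IsEndVia M H φ)
    (c : g.carrier →ₗ[k] M.carrier →ₗ[k] M.carrier) (hc : IsCocycle M c) : SupMod g where
  carrier := k × H.carrier
  ev := (⊤ : Submodule k k).prod H.ev
  od := (⊥ : Submodule k k).prod H.od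
  isCompl := by
    constructor
    · rw [Submodule.disjoint_def]
      rintro ⟨a, b⟩ ⟨_, hb⟩ ⟨ha, hb'⟩
      have h1 : a = 0 := by simpa using ha
      have h2 : b = 0 := H.eq_zero_of_ev_od hb hb'
      simp [h1, h2]
    · rw [codisjoint_iff, eq_top_iff]
      rintro ⟨a, b⟩ -
      obtain ⟨u, hu, v, hv, rfl⟩ := H.exists_parts b
      exact Submodule.mem_sup.mpr ⟨(a, u), ⟨trivial, hu⟩, (0, v), ⟨by simp, hv⟩, by simp⟩
  ρ := extRho M H φ c
  ρ_ev_ev := by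
    rintro x hx ⟨a, h⟩ ⟨_, hh⟩
    exact ⟨trivial, H.ρ_ev_ev x hx h hh⟩
  ρ_ev_od := by
    rintro x hx ⟨a, h⟩ ⟨_, hh⟩
    rw [extRho_apply]
    refine ⟨?_, H.ρ_ev_od x hx h hh⟩
    simp [hc.ev x hx]
  ρ_od_ev := by
    rintro x hx ⟨a, h⟩ ⟨_, hh⟩
    rw [extRho_apply]
    refine ⟨?_, H.ρ_od_ev x hx h hh⟩
    have := (hφ.1 h).mp hh
    have e := M.trace_sigma_odd (f := c x ∘ₗ φ h)
      (fun m hm => hc.od_ev x hx _ (this.1 m hm)) (fun m hm => hc.od_od x hx _ (this.2 m hm))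
    exact e
  ρ_od_od := by
    rintro x hx ⟨a, h⟩ ⟨_, hh⟩
    exact ⟨trivial, H.ρ_od_od x hx h hh⟩
  ρ_bracket_ev := by
    intro x hx y
    refine LinearMap.ext fun p => ?_
    simp only [LinearMap.sub_apply, LinearMap.comp_apply, extRho_apply]
    refine Prod.ext ?_ ?_
    · simp only [Prod.fst_sub, hc.equiv x hx y, hc.ev x hx, hφ.act_ev hx]
      have := tr_even M.sigma (M.ρ x) (c y) (φ p.2)
        (M.sigma_even (M.ρ_ev_ev x hx) (M.ρ_ev_od x hx))
      simp only [zero_mul, mul_zero, map_zero, zero_sub]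
      exact this
    · simp [H.ρ_bracket_ev x hx y]
  ρ_bracket_od := by
    intro x hx y hy
    refine LinearMap.ext fun p => ?_
    simp only [LinearMap.add_apply, LinearMap.comp_apply, extRho_apply]
    refine Prod.ext ?_ ?_
    · simp only [Prod.fst_add, hc.ev _ (g.bracket_od_od x hx y hy), hφ.act_od hx, hφ.act_od hy]
      rw [tr_odd M.sigma (M.ρ y) (c x) (φ p.2) M.sigma_mul_sigma
        (M.sigma_odd (hc.od_ev x hx) (hc.od_od x hx)),
        tr_odd M.sigma (M.ρ x) (c y) (φ p.2) M.sigma_mul_sigma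
        (M.sigma_odd (hc.od_ev y hy) (hc.od_od y hy)), ← map_add, ← mul_add, ← add_mul]
      have e : ((c x : Module.End k M.carrier) * M.ρ y + (M.ρ y : Module.End k M.carrier) * c x
          + ((c y : Module.End k M.carrier) * M.ρ x + (M.ρ x : Module.End k M.carrier) * c y))
          = 0 := by
        rw [← hc.coc x hx y hy]
        simp only [Module.End.mul_eq_comp]
        abel
      rw [e]
    · simp [H.ρ_bracket_od x hx y hy]
  completelyReducible := by
    intro N hN
    obtain ⟨N', h1, h2⟩ := compl_prod (g.ev : Set g.carrier) (fun _ => (0 : k →ₗ[k] k)) H.ρ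
      (fun N _ => by
        obtain ⟨N', h⟩ := compl_field N
        exact ⟨N', fun _ _ _ _ => by simp, h⟩)
      H.completelyReducible N (by
        intro x hx m hm
        have := hN x hx m hm
        rw [extRho_apply, hc.ev x hx] at this
        simpa using this)
    refine ⟨N', ?_, h2⟩
    intro x hx m hm
    have := h1 x hx m hm
    rw [extRho_apply, hc.ev x hx]
    simpa using this

end SupMod

end LieSup

end

noncomputable section

namespace LieSup

namespace SupMod

variable {k : Type} [Field k] {g : LieSuperAlg k}

theorem rigid_aux [CharZero k] (M H K P S : SupMod g)
    (φ : H.carrier ≃ₗ[k] (M.carrier →ₗ[k] M.carrier)) (hφ : IsEndVia M H φ)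
    (hK : IsTrivial false K) (hP : IsProjective P) (hS : IsDsum K P S) (hHS : Iso H S)
    (c : g.carrier →ₗ[k] M.carrier →ₗ[k] M.carrier) (hc : IsCocycle M c) :
    ∃ l : H.carrier →ₗ[k] k, (∀ h ∈ H.od, l h = 0) ∧
      ∀ x h, l (H.ρ x h) =
        LinearMap.trace k M.carrier ((M.sigma : Module.End k M.carrier) * (c x * φ h)) := by
  obtain ⟨e, he, he0, he1⟩ := hHS
  obtain ⟨ψ, hψ0, hψ1, hψ⟩ := hS
  have hKtop : K.ev = ⊤ := by simpa using hK.2.2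
  let Φ : H.carrier ≃ₗ[k] K.carrier × P.carrier := e.trans ψ
  have hΦ0 : ∀ h ∈ H.ev, (Φ h).1 ∈ K.ev ∧ (Φ h).2 ∈ P.ev := fun h hh => (hψ0 _).mp (he0 h hh)
  have hΦ1 : ∀ h ∈ H.od, (Φ h).1 ∈ K.od ∧ (Φ h).2 ∈ P.od := fun h hh => (hψ1 _).mp (he1 h hh)
  have hΦ : ∀ x h, Φ (H.ρ x h) = (K.ρ x (Φ h).1, P.ρ x (Φ h).2) := by
    intro x h
    have := LinearMap.congr_fun (he x) h
    simp only [LinearMap.comp_apply, LinearEquiv.coe_coe] at this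
    simp only [Φ, LinearEquiv.trans_apply, this, hψ]
    rfl
  have hΦ0' : ∀ h, (Φ h).1 ∈ K.ev → (Φ h).2 ∈ P.ev → h ∈ H.ev := by
    intro h h0 h1
    obtain ⟨a, ha, b, hb, rfl⟩ := H.exists_parts h
    have ha' := hΦ0 a ha
    have hb' := hΦ1 b hb
    have hb0 : Φ b = 0 := by
      rw [map_add, Prod.fst_add] at h0
      rw [map_add, Prod.snd_add] at h1
      exact Prod.ext (K.eq_zero_of_ev_od ((Submodule.add_mem_iff_right _ ha'.1).mp h0) hb'.1)
        (P.eq_zero_of_ev_od ((Submodule.add_mem_iff_right _ ha'.2).mp h1) hb'.2)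
    rw [(map_eq_zero_iff Φ Φ.injective).mp hb0, add_zero]
    exact ha
  have hΦ1' : ∀ h, (Φ h).1 ∈ K.od → (Φ h).2 ∈ P.od → h ∈ H.od := by
    intro h h0 h1
    obtain ⟨a, ha, b, hb, rfl⟩ := H.exists_parts h
    have ha' := hΦ0 a ha
    have hb' := hΦ1 b hb
    have hb0 : Φ a = 0 := by
      rw [map_add, Prod.fst_add] at h0
      rw [map_add, Prod.snd_add] at h1
      exact Prod.ext (K.eq_zero_of_ev_od ha'.1 ((Submodule.add_mem_iff_left _ hb'.1).mp h0))
        (P.eq_zero_of_ev_od ha'.2 ((Submodule.add_mem_iff_left _ hb'.2).mp h1))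
    rw [(map_eq_zero_iff Φ Φ.injective).mp hb0, zero_add]
    exact hb
  let E := extMod M H φ hφ c hc
  let π : E.carrier →ₗ[k] H.carrier := LinearMap.snd k k H.carrier
  have hπ : IsHom E H π := by
    refine ⟨fun x => rfl, fun m hm => hm.2, fun m hm => hm.2⟩
  let f : P.carrier →ₗ[k] H.carrier :=
    (Φ.symm : K.carrier × P.carrier →ₗ[k] H.carrier) ∘ₗ LinearMap.inr k K.carrier P.carrier
  have hfΦ : ∀ p, Φ (f p) = (0, p) := by intro p; simp [f]
  have hf : IsHom P H f := by
    refine ⟨?_, ?_, ?_⟩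
    · intro x
      refine LinearMap.ext fun p => Φ.injective ?_
      simp only [LinearMap.comp_apply]
      rw [hΦ, hfΦ, hfΦ]
      simp
    · intro p hp
      apply hΦ0' <;> rw [hfΦ]
      · exact K.ev.zero_mem
      · exact hp
    · intro p hp
      apply hΦ1' <;> rw [hfΦ]
      · exact K.od.zero_mem
      · exact hp
  obtain ⟨s, hs, hsf⟩ := hP E H π f hπ Prod.snd_surjective hf
  have hs2 : ∀ p, (s p : k × H.carrier).2 = f p := fun p => LinearMap.congr_fun hsf p
  let l0 : P.carrier →ₗ[k] k := LinearMap.fst k k H.carrier ∘ₗ s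
  refine ⟨l0 ∘ₗ LinearMap.snd k K.carrier P.carrier ∘ₗ (Φ : H.carrier →ₗ[k] _), ?_, ?_⟩
  · intro h hh
    have := hs.2.2 _ (hΦ1 h hh).2
    exact (Submodule.mem_bot k).mp this.1
  · intro x h
    have e1 : (l0 ∘ₗ LinearMap.snd k K.carrier P.carrier ∘ₗ (Φ : H.carrier →ₗ[k] _)) (H.ρ x h)
        = (s (P.ρ x (Φ h).2) : k × H.carrier).1 := by
      rw [LinearMap.comp_apply, LinearMap.comp_apply, LinearEquiv.coe_coe, hΦ]
      rfl
    rw [e1]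
    have e2 := LinearMap.congr_fun (hs.1 x) (Φ h).2
    simp only [LinearMap.comp_apply] at e2
    rw [e2]
    have e3 : (E.ρ x (s (Φ h).2) : k × H.carrier).1 =
      LinearMap.trace k M.carrier ((M.sigma : Module.End k M.carrier)
        * (c x * φ (s (Φ h).2 : k × H.carrier).2)) := rfl
    rw [e3, hs2]
    have e4 : h = Φ.symm ((Φ h).1, 0) + f (Φ h).2 := by
      apply Φ.injective
      rw [map_add, hfΦ]
      simp
    have e5 : Φ.symm ((Φ h).1, 0) ∈ H.ev := by
      apply hΦ0'
      · rw [hKtop]; trivial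
      · simp
    have e6 : LinearMap.trace k M.carrier ((M.sigma : Module.End k M.carrier) *
        (c x * φ (Φ.symm ((Φ h).1, 0)))) = 0 := by
      obtain ⟨a, ha, b, hb, rfl⟩ := g.exists_parts x
      rw [map_add, hc.ev a ha, zero_add]
      have := (hφ.1 _).mp e5
      exact M.trace_sigma_odd (f := c b ∘ₗ φ (Φ.symm ((Φ h).1, 0)))
        (fun m hm => hc.od_ev b hb _ (this.1 m hm)) (fun m hm => hc.od_od b hb _ (this.2 m hm))
    conv_rhs => rw [e4]
    rw [map_add, mul_add, mul_add, map_add, e6, zero_add]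

theorem eq_zero_of_eq_neg {k V : Type} [Field k] [CharZero k] [AddCommGroup V] [Module k V]
    {b : V} (h : b = -b) : b = 0 := by
  have h2 : (2 : k) • b = 0 := by
    rw [two_smul]
    nth_rewrite 1 [h]
    simp
  exact (smul_eq_zero.mp h2).resolve_left two_ne_zero

theorem mem_ev_of_sigma [CharZero k] (M : SupMod g) {m : M.carrier} (h : M.sigma m = m) :
    m ∈ M.ev := by
  obtain ⟨a, ha, b, hb, rfl⟩ := M.exists_parts m
  rw [map_add, M.sigma_ev ha, M.sigma_od hb, add_right_inj] at h
  have := eq_zero_of_eq_neg (k := k) h.symm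
  rw [this, add_zero]
  exact ha

theorem mem_od_of_sigma [CharZero k] (M : SupMod g) {m : M.carrier} (h : M.sigma m = -m) :
    m ∈ M.od := by
  obtain ⟨a, ha, b, hb, rfl⟩ := M.exists_parts m
  rw [map_add, M.sigma_ev ha, M.sigma_od hb, neg_add, add_left_inj] at h
  have := eq_zero_of_eq_neg (k := k) h
  rw [this, zero_add]
  exact hb

/-- Endotrivial modules are rigid: every even `g₀`-relative one-cocycle with values in `End M`
is a coboundary. -/
theorem rigid [CharZero k] (M : SupMod g) (hM : IsEndotrivial M)
    (c : g.carrier →ₗ[k] M.carrier →ₗ[k] M.carrier) (hc : IsCocycle M c) :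
    ∃ f : M.carrier →ₗ[k] M.carrier, (∀ m ∈ M.ev, f m ∈ M.ev) ∧ (∀ m ∈ M.od, f m ∈ M.od) ∧
      ∀ x, c x = f ∘ₗ M.ρ x - M.ρ x ∘ₗ f := by
  obtain ⟨H, K, P, S, ⟨φ, hφ⟩, hK, hP, hS, hHS⟩ := hM
  have hφ : IsEndVia M H φ := hφ
  obtain ⟨l, hl0, hl⟩ := rigid_aux M H K P S φ hφ hK hP hS hHS c hc
  obtain ⟨f', hf'⟩ := trace_repr (l ∘ₗ (φ.symm : (M.carrier →ₗ[k] M.carrier) →ₗ[k] H.carrier))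
  let s : Module.End k M.carrier := M.sigma
  have hss : s * s = 1 := M.sigma_mul_sigma
  let f : Module.End k M.carrier := s * f'
  have hf : ∀ h, l h = LinearMap.trace k M.carrier (s * (f * φ h)) := by
    intro h
    have := hf' (φ h)
    simp only [LinearMap.comp_apply, LinearEquiv.coe_coe, LinearEquiv.symm_apply_apply] at this
    rw [this]
    congr 1
    simp only [f, ← mul_assoc, hss, one_mul]
  have inj : ∀ a b : Module.End k M.carrier,
      (∀ h, LinearMap.trace k M.carrier (s * (a * φ h))
        = LinearMap.trace k M.carrier (s * (b * φ h))) → a = b := by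
    intro a b hab
    have : s * (a - b) = 0 := by
      apply trace_nondeg
      intro u
      have := hab (φ.symm u)
      rw [φ.apply_symm_apply] at this
      rw [mul_sub, sub_mul, map_sub, sub_eq_zero]
      simpa only [mul_assoc] using this
    have h2 := congrArg (fun z => s * z) this
    simp only [← mul_assoc, hss, one_mul, mul_zero] at h2
    exact sub_eq_zero.mp h2
  have hsf : s * f = f * s := by
    have : s * f * s = f := by
      apply inj
      intro h
      rw [← hf h]
      have e1 : l h = l (φ.symm (s * φ h * s)) := by
        rw [← sub_eq_zero, ← map_sub]
        apply hl0
        rw [hφ.2.1]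
        simp only [map_sub, LinearEquiv.apply_symm_apply]
        constructor
        · intro m hm
          apply M.mem_od_of_sigma
          have h2 := LinearMap.congr_fun hss (φ h m)
          simp only [s, Module.End.mul_apply, Module.End.one_apply] at h2
          simp [s, M.sigma_ev hm, h2]
        · intro m hm
          apply M.mem_ev_of_sigma
          have h2 := LinearMap.congr_fun hss (φ h m)
          simp only [s, Module.End.mul_apply, Module.End.one_apply] at h2
          simp [s, M.sigma_od hm, h2, add_comm]
      rw [e1, hf, φ.apply_symm_apply]
      have a1 : s * (s * f * s * φ h) = f * (s * φ h) := by
        simp only [← mul_assoc, hss, one_mul]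
      have a2 : s * (f * (s * φ h * s)) = s * (f * (s * φ h) * s) := by
        simp only [mul_assoc]
      rw [a1, a2, LinearMap.trace_mul_comm k s (f * (s * φ h) * s)]
      simp only [mul_assoc, hss, mul_one]
    calc s * f = s * f * (s * s) := by rw [hss, mul_one]
      _ = (s * f * s) * s := by simp only [mul_assoc]
      _ = f * s := by rw [this]
  refine ⟨f, ?_, ?_, ?_⟩
  · intro m hm
    apply M.mem_ev_of_sigma
    have := LinearMap.congr_fun hsf m
    simp only [s, Module.End.mul_apply, M.sigma_ev hm] at this
    exact this
  · intro m hm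
    apply M.mem_od_of_sigma
    have := LinearMap.congr_fun hsf m
    simp only [s, Module.End.mul_apply, M.sigma_od hm, map_neg] at this
    exact this
  · have hev : ∀ x ∈ g.ev, c x = f ∘ₗ M.ρ x - M.ρ x ∘ₗ f := by
      intro x hx
      apply inj
      intro h
      have h1 := hl x h
      rw [hf, hφ.act_ev hx] at h1
      have h2 := tr_even s (M.ρ x) f (φ h) (M.sigma_even (M.ρ_ev_ev x hx) (M.ρ_ev_od x hx))
      have h3 : LinearMap.trace k M.carrier (s * ((f * M.ρ x - M.ρ x * f) * φ h)) =
          - LinearMap.trace k M.carrier (s * ((M.ρ x * f - f * M.ρ x) * φ h)) := by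
        rw [← map_neg, ← mul_neg, ← neg_mul, neg_sub]
      rw [h2, neg_neg, h1] at h3
      exact h3.symm
    have hod : ∀ x ∈ g.od, c x = f ∘ₗ M.ρ x - M.ρ x ∘ₗ f := by
      intro x hx
      apply inj
      intro h
      have h1 := hl x h
      rw [hf, hφ.act_od hx] at h1
      have h2 := tr_odd' s (M.ρ x) f (φ h) hss hsf
      exact h1.symm.trans h2
    intro x
    obtain ⟨a, ha, b, hb, rfl⟩ := g.exists_parts x
    rw [map_add, map_add, hev a ha, hod b hb, LinearMap.comp_add, LinearMap.add_comp]
    abel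

end SupMod

end LieSup

end

noncomputable section

namespace LieSup

namespace SupMod

variable {k : Type} [Field k] {g : LieSuperAlg k}

/-- graded linear isomorphisms, equivariant for `g₀` -/
def Iso0 (M N : SupMod g) : Prop :=
  ∃ e : M.carrier ≃ₗ[k] N.carrier, (∀ m ∈ M.ev, e m ∈ N.ev) ∧ (∀ m ∈ M.od, e m ∈ N.od) ∧
    ∀ x ∈ g.ev, ∀ m, e (M.ρ x m) = N.ρ x (e m)

theorem symm_ev {M N : SupMod g} (e : M.carrier ≃ₗ[k] N.carrier)
    (h0 : ∀ m ∈ M.ev, e m ∈ N.ev) (h1 : ∀ m ∈ M.od, e m ∈ N.od) :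
    ∀ n ∈ N.ev, e.symm n ∈ M.ev := by
  intro n hn
  obtain ⟨m, rfl⟩ := e.surjective n
  obtain ⟨a, ha, b, hb, rfl⟩ := M.exists_parts m
  rw [e.symm_apply_apply]
  rw [map_add] at hn
  have := N.eq_zero_of_ev_od ((Submodule.add_mem_iff_right _ (h0 a ha)).mp hn) (h1 b hb)
  rw [(map_eq_zero_iff e e.injective).mp this, add_zero]
  exact ha

theorem symm_od {M N : SupMod g} (e : M.carrier ≃ₗ[k] N.carrier)
    (h0 : ∀ m ∈ M.ev, e m ∈ N.ev) (h1 : ∀ m ∈ M.od, e m ∈ N.od) :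
    ∀ n ∈ N.od, e.symm n ∈ M.od := by
  intro n hn
  obtain ⟨m, rfl⟩ := e.surjective n
  obtain ⟨a, ha, b, hb, rfl⟩ := M.exists_parts m
  rw [e.symm_apply_apply]
  rw [map_add] at hn
  have := N.eq_zero_of_ev_od (h0 a ha) ((Submodule.add_mem_iff_left _ (h1 b hb)).mp hn)
  rw [(map_eq_zero_iff e e.injective).mp this, zero_add]
  exact hb

theorem Iso.symm {M N : SupMod g} (h : Iso M N) : Iso N M := by
  obtain ⟨e, he, h0, h1⟩ := h
  refine ⟨e.symm, ?_, symm_ev e h0 h1, symm_od e h0 h1⟩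
  intro x
  refine LinearMap.ext fun n => ?_
  obtain ⟨m, rfl⟩ := e.surjective n
  have := LinearMap.congr_fun (he x) m
  simp only [LinearMap.comp_apply, LinearEquiv.coe_coe] at this
  simp [← this]

theorem Iso.trans {M N Q : SupMod g} (h : Iso M N) (h' : Iso N Q) : Iso M Q := by
  obtain ⟨e, he, h0, h1⟩ := h
  obtain ⟨e', he', h0', h1'⟩ := h'
  refine ⟨e.trans e', ?_, fun m hm => h0' _ (h0 m hm), fun m hm => h1' _ (h1 m hm)⟩
  intro x
  refine LinearMap.ext fun m => ?_
  have a := LinearMap.congr_fun (he x) m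
  have b := LinearMap.congr_fun (he' x) (e m)
  simp only [LinearMap.comp_apply, LinearEquiv.coe_coe] at a b
  simp [a, b]

theorem Iso.iso0 {M N : SupMod g} (h : Iso M N) : Iso0 M N := by
  obtain ⟨e, he, h0, h1⟩ := h
  exact ⟨e, h0, h1, fun x _ m => LinearMap.congr_fun (he x) m⟩

theorem Iso0.symm {M N : SupMod g} (h : Iso0 M N) : Iso0 N M := by
  obtain ⟨e, h0, h1, he⟩ := h
  refine ⟨e.symm, symm_ev e h0 h1, symm_od e h0 h1, ?_⟩
  intro x hx n
  obtain ⟨m, rfl⟩ := e.surjective n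
  simp [← he x hx]

theorem Iso0.trans {M N Q : SupMod g} (h : Iso0 M N) (h' : Iso0 N Q) : Iso0 M Q := by
  obtain ⟨e, h0, h1, he⟩ := h
  obtain ⟨e', h0', h1', he'⟩ := h'
  refine ⟨e.trans e', fun m hm => h0' _ (h0 m hm), fun m hm => h1' _ (h1 m hm), ?_⟩
  intro x hx m
  simp [he x hx, he' x hx]

theorem sigma_iso {M N : SupMod g} (e : M.carrier ≃ₗ[k] N.carrier)
    (h0 : ∀ m ∈ M.ev, e m ∈ N.ev) (h1 : ∀ m ∈ M.od, e m ∈ N.od) (m : M.carrier) :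
    e (M.sigma m) = N.sigma (e m) := by
  obtain ⟨a, ha, b, hb, rfl⟩ := M.exists_parts m
  simp [M.sigma_ev ha, M.sigma_od hb, N.sigma_ev (h0 a ha), N.sigma_od (h1 b hb)]

theorem IsEndotrivial.of_iso {M N : SupMod g} (h : Iso M N) (hM : IsEndotrivial M) :
    IsEndotrivial N := by
  obtain ⟨H, K, P, S, ⟨φ, hφ0, hφ1, hφ⟩, hrest⟩ := hM
  refine ⟨H, K, P, S, ?_, hrest⟩
  obtain ⟨e, he, h0, h1⟩ := h
  have h0 : ∀ m ∈ M.ev, e m ∈ N.ev := h0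
  have h1 : ∀ m ∈ M.od, e m ∈ N.od := h1
  have s0 := symm_ev e h0 h1
  have s1 := symm_od e h0 h1
  have he' : ∀ x m, e (M.ρ x m) = N.ρ x (e m) := fun x m => LinearMap.congr_fun (he x) m
  refine ⟨φ.trans e.conj, ?_, ?_, ?_⟩
  · intro h
    rw [hφ0]
    simp only [LinearEquiv.trans_apply, LinearEquiv.conj_apply_apply]
    constructor
    · rintro ⟨a, b⟩
      exact ⟨fun m hm => h0 _ (a _ (s0 m hm)), fun m hm => h1 _ (b _ (s1 m hm))⟩
    · rintro ⟨a, b⟩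
      refine ⟨fun m hm => ?_, fun m hm => ?_⟩
      · have := s0 _ (a _ (h0 m hm)); simpa using this
      · have := s1 _ (b _ (h1 m hm)); simpa using this
  · intro h
    rw [hφ1]
    simp only [LinearEquiv.trans_apply, LinearEquiv.conj_apply_apply]
    constructor
    · rintro ⟨a, b⟩
      exact ⟨fun m hm => h1 _ (a _ (s0 m hm)), fun m hm => h0 _ (b _ (s1 m hm))⟩
    · rintro ⟨a, b⟩
      refine ⟨fun m hm => ?_, fun m hm => ?_⟩
      · have := s1 _ (a _ (h0 m hm)); simpa using this
      · have := s0 _ (b _ (h1 m hm)); simpa using this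
  · intro x h
    refine LinearMap.ext fun n => ?_
    obtain ⟨m, rfl⟩ := e.surjective n
    simp only [LinearEquiv.trans_apply, LinearEquiv.conj_apply_apply, LinearEquiv.symm_apply_apply,
      hφ, LinearMap.sub_apply, LinearMap.comp_apply, map_sub,
      ← he', ← sigma_iso e h0 h1]

/-- `θ` is a `g`-module structure on `W` extending the given `g₀`-structure. -/
structure IsStr (W : SupMod g) (θ : g.carrier →ₗ[k] W.carrier →ₗ[k] W.carrier) : Prop where
  ev : ∀ x ∈ g.ev, θ x = W.ρ x
  od_ev : ∀ x ∈ g.od, ∀ m ∈ W.ev, θ x m ∈ W.od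
  od_od : ∀ x ∈ g.od, ∀ m ∈ W.od, θ x m ∈ W.ev
  bracket_ev : ∀ x ∈ g.ev, ∀ y, θ (g.bracket x y) = θ x ∘ₗ θ y - θ y ∘ₗ θ x
  bracket_od : ∀ x ∈ g.od, ∀ y ∈ g.od, θ (g.bracket x y) = θ x ∘ₗ θ y + θ y ∘ₗ θ x

/-- The supermodule with structure `θ`. -/
def mkSup (W : SupMod g) (θ : {θ // IsStr W θ}) : SupMod g where
  carrier := W.carrier
  ev := W.ev
  od := W.od
  isCompl := W.isCompl
  ρ := θ.1
  ρ_ev_ev := fun x hx m hm => by rw [θ.2.ev x hx]; exact W.ρ_ev_ev x hx m hm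
  ρ_ev_od := fun x hx m hm => by rw [θ.2.ev x hx]; exact W.ρ_ev_od x hx m hm
  ρ_od_ev := θ.2.od_ev
  ρ_od_od := θ.2.od_od
  ρ_bracket_ev := θ.2.bracket_ev
  ρ_bracket_od := θ.2.bracket_od
  completelyReducible := by
    intro N hN
    obtain ⟨N', h1, h2⟩ := W.completelyReducible N
      (fun x hx m hm => by rw [← θ.2.ev x hx]; exact hN x hx m hm)
    exact ⟨N', fun x hx m hm => by rw [θ.2.ev x hx]; exact h1 x hx m hm, h2⟩

theorem exists_mkSup {M W : SupMod g} (h : Iso0 M W) :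
    ∃ θ : {θ // IsStr W θ}, Iso M (mkSup W θ) := by
  obtain ⟨e, h0, h1, he⟩ := h
  have s0 := symm_ev e h0 h1
  have s1 := symm_od e h0 h1
  let θ : g.carrier →ₗ[k] W.carrier →ₗ[k] W.carrier :=
    (e.conj : Module.End k M.carrier →ₗ[k] Module.End k W.carrier) ∘ₗ M.ρ
  have hθ : ∀ x w, θ x w = e (M.ρ x (e.symm w)) := fun x w => rfl
  have hS : IsStr W θ := by
    refine ⟨?_, ?_, ?_, ?_, ?_⟩
    · intro x hx
      refine LinearMap.ext fun w => ?_
      rw [hθ, he x hx, e.apply_symm_apply]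
    · intro x hx m hm
      exact h1 _ (M.ρ_od_ev x hx _ (s0 m hm))
    · intro x hx m hm
      exact h0 _ (M.ρ_od_od x hx _ (s1 m hm))
    · intro x hx y
      refine LinearMap.ext fun w => ?_
      simp [hθ, M.ρ_bracket_ev x hx y]
    · intro x hx y hy
      refine LinearMap.ext fun w => ?_
      simp [hθ, M.ρ_bracket_od x hx y hy]
  refine ⟨⟨θ, hS⟩, e, ?_, h0, h1⟩
  intro x
  refine LinearMap.ext fun m => ?_
  show e (M.ρ x m) = θ x (e m)
  rw [hθ, e.symm_apply_apply]

end SupMod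

end LieSup

end

noncomputable section

namespace LieSup

namespace SupMod

variable {k : Type} [Field k] {g : LieSuperAlg k}

/-- zero-cochains: even `g₀`-equivariant endomorphisms -/
def C0 (W : SupMod g) : Submodule k (W.carrier →ₗ[k] W.carrier) where
  carrier := {f | (∀ m ∈ W.ev, f m ∈ W.ev) ∧ (∀ m ∈ W.od, f m ∈ W.od) ∧
    ∀ x ∈ g.ev, f ∘ₗ W.ρ x = W.ρ x ∘ₗ f}
  add_mem' := by
    rintro a b ⟨a0, a1, a2⟩ ⟨b0, b1, b2⟩
    refine ⟨fun m hm => W.ev.add_mem (a0 m hm) (b0 m hm),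
      fun m hm => W.od.add_mem (a1 m hm) (b1 m hm), fun x hx => ?_⟩
    rw [LinearMap.add_comp, LinearMap.comp_add, a2 x hx, b2 x hx]
  zero_mem' := ⟨fun m _ => by simp, fun m _ => by simp, fun x _ => by simp⟩
  smul_mem' := by
    rintro r b ⟨b0, b1, b2⟩
    refine ⟨fun m hm => W.ev.smul_mem r (b0 m hm),
      fun m hm => W.od.smul_mem r (b1 m hm), fun x hx => ?_⟩
    rw [LinearMap.smul_comp, LinearMap.comp_smul, b2 x hx]

/-- one-cochains -/
def C1 (W : SupMod g) : Submodule k (g.carrier →ₗ[k] W.carrier →ₗ[k] W.carrier) where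
  carrier := {c | IsCochain W c}
  add_mem' := by
    rintro a b ha hb
    refine ⟨fun x hx => ?_, fun x hx m hm => W.od.add_mem (ha.od_ev x hx m hm) (hb.od_ev x hx m hm),
      fun x hx m hm => W.ev.add_mem (ha.od_od x hx m hm) (hb.od_od x hx m hm), fun x hx y => ?_⟩
    · rw [LinearMap.add_apply, ha.ev x hx, hb.ev x hx, add_zero]
    · simp only [LinearMap.add_apply, ha.equiv x hx, hb.equiv x hx, LinearMap.comp_add,
        LinearMap.add_comp]
      abel
  zero_mem' := ⟨fun _ _ => rfl, fun _ _ _ _ => by simp, fun _ _ _ _ => by simp,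
    fun _ _ _ => by simp⟩
  smul_mem' := by
    rintro r b hb
    refine ⟨fun x hx => ?_, fun x hx m hm => W.od.smul_mem r (hb.od_ev x hx m hm),
      fun x hx m hm => W.ev.smul_mem r (hb.od_od x hx m hm), fun x hx y => ?_⟩
    · rw [LinearMap.smul_apply, hb.ev x hx, smul_zero]
    · simp only [LinearMap.smul_apply, hb.equiv x hx, LinearMap.comp_smul,
        LinearMap.smul_comp, smul_sub]

/-- left composition with values of `θ`, as a linear function of `θ` -/
def rawL (W : SupMod g) (f : W.carrier →ₗ[k] W.carrier) :
    (g.carrier →ₗ[k] W.carrier →ₗ[k] W.carrier) →ₗ[k]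
      (g.carrier →ₗ[k] W.carrier →ₗ[k] W.carrier) where
  toFun θ := LinearMap.mk₂ k (fun x m => θ x (f m)) (by simp) (by simp) (by simp) (by simp)
  map_add' a b := by ext; simp
  map_smul' a b := by ext; simp

/-- right composition with values of `θ` -/
def rawR (W : SupMod g) (θ : g.carrier →ₗ[k] W.carrier →ₗ[k] W.carrier)
    (f : W.carrier →ₗ[k] W.carrier) : g.carrier →ₗ[k] W.carrier →ₗ[k] W.carrier :=
  LinearMap.mk₂ k (fun x m => f (θ x m)) (by simp) (by simp) (by simp) (by simp)

theorem d0_mem (W : SupMod g) (θ₀ θ : {θ // IsStr W θ}) (f : C0 W) :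
    rawR W θ₀.1 f.1 - rawL W f.1 θ.1 ∈ C1 W := by
  obtain ⟨f, f0, f1, f2⟩ := f
  have f2' : ∀ x ∈ g.ev, ∀ m, f (W.ρ x m) = W.ρ x (f m) :=
    fun x hx m => LinearMap.congr_fun (f2 x hx) m
  refine ⟨fun x hx => ?_, fun x hx m hm => ?_, fun x hx m hm => ?_, fun x hx y => ?_⟩
  · refine LinearMap.ext fun m => ?_
    simp [rawR, rawL, θ₀.2.ev x hx, θ.2.ev x hx, f2' x hx]
  · exact W.od.sub_mem (f1 _ (θ₀.2.od_ev x hx m hm)) (θ.2.od_ev x hx _ (f0 m hm))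
  · exact W.ev.sub_mem (f0 _ (θ₀.2.od_od x hx m hm)) (θ.2.od_od x hx _ (f1 m hm))
  · refine LinearMap.ext fun m => ?_
    simp [rawR, rawL, θ₀.2.bracket_ev x hx y, θ.2.bracket_ev x hx y, θ₀.2.ev x hx, θ.2.ev x hx,
      f2' x hx]
    abel

/-- the first differential -/
def d0 (W : SupMod g) (θ₀ θ : {θ // IsStr W θ}) : C0 W →ₗ[k] C1 W where
  toFun f := ⟨_, d0_mem W θ₀ θ f⟩
  map_add' a b := by
    apply Subtype.ext
    ext x m
    simp [rawR, rawL]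
    abel
  map_smul' a b := by
    apply Subtype.ext
    ext x m
    simp [rawR, rawL, smul_sub]

theorem d0_apply (W : SupMod g) (θ₀ θ : {θ // IsStr W θ}) (f : C0 W) (x : g.carrier)
    (m : W.carrier) : (d0 W θ₀ θ f).1 x m = f.1 (θ₀.1 x m) - θ.1 x (f.1 m) := rfl

/-- part of the second differential depending on `θ` -/
def rawQ (W : SupMod g) (c : g.carrier →ₗ[k] W.carrier →ₗ[k] W.carrier) :
    (g.carrier →ₗ[k] W.carrier →ₗ[k] W.carrier) →ₗ[k]
      (g.od →ₗ[k] g.od →ₗ[k] (W.carrier →ₗ[k] W.carrier)) where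
  toFun θ := LinearMap.mk₂ k (fun x y => θ x ∘ₗ c y + θ y ∘ₗ c x)
    (by intros; ext; simp; abel) (by intros; ext; simp) (by intros; ext; simp; abel)
    (by intros; ext; simp)
  map_add' a b := by
    refine LinearMap.ext fun x => LinearMap.ext fun y => LinearMap.ext fun m => ?_
    simp
    abel
  map_smul' a b := by
    refine LinearMap.ext fun x => LinearMap.ext fun y => LinearMap.ext fun m => ?_
    simp

/-- part of the second differential not depending on `θ` -/
def rawQ' (W : SupMod g) (θ₀ c : g.carrier →ₗ[k] W.carrier →ₗ[k] W.carrier) :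
    (g.od →ₗ[k] g.od →ₗ[k] (W.carrier →ₗ[k] W.carrier)) :=
  LinearMap.mk₂ k (fun x y => c x ∘ₗ θ₀ y + c y ∘ₗ θ₀ x)
    (by intros; ext; simp; abel) (by intros; ext; simp) (by intros; ext; simp; abel)
    (by intros; ext; simp)

/-- the second differential -/
def d1 (W : SupMod g) (θ₀ θ : {θ // IsStr W θ}) :
    C1 W →ₗ[k] (g.od →ₗ[k] g.od →ₗ[k] (W.carrier →ₗ[k] W.carrier)) where
  toFun c := rawQ W c.1 θ.1 + rawQ' W θ₀.1 c.1
  map_add' a b := by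
    refine LinearMap.ext fun x => LinearMap.ext fun y => LinearMap.ext fun m => ?_
    simp [rawQ, rawQ']
    abel
  map_smul' a b := by
    refine LinearMap.ext fun x => LinearMap.ext fun y => LinearMap.ext fun m => ?_
    simp [rawQ, rawQ']

theorem d1_apply (W : SupMod g) (θ₀ θ : {θ // IsStr W θ}) (c : C1 W) (x y : g.od) :
    d1 W θ₀ θ c x y = θ.1 x ∘ₗ c.1 y + θ.1 y ∘ₗ c.1 x + (c.1 x ∘ₗ θ₀.1 y + c.1 y ∘ₗ θ₀.1 x) := rfl

theorem d1_d0 (W : SupMod g) (θ₀ θ : {θ // IsStr W θ}) (f : C0 W) :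
    d1 W θ₀ θ (d0 W θ₀ θ f) = 0 := by
  refine LinearMap.ext fun x => LinearMap.ext fun y => LinearMap.ext fun m => ?_
  rw [d1_apply]
  simp only [LinearMap.add_apply, LinearMap.comp_apply, d0_apply, map_sub, LinearMap.zero_apply]
  have hxy := g.bracket_od_od x x.2 y y.2
  have e1 := LinearMap.congr_fun (θ₀.2.bracket_od x x.2 y y.2) m
  have e2 := LinearMap.congr_fun (θ.2.bracket_od x x.2 y y.2) (f.1 m)
  rw [θ₀.2.ev _ hxy] at e1
  rw [θ.2.ev _ hxy] at e2
  have e3 := LinearMap.congr_fun (f.2.2.2 _ hxy) m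
  simp only [LinearMap.comp_apply, LinearMap.add_apply] at e1 e2 e3
  rw [e1, e2, map_add] at e3
  have e4 := sub_eq_zero.mpr e3
  rw [← e4]
  abel

end SupMod

end LieSup

end

noncomputable section

namespace LieSup

namespace SupMod

variable {k : Type} [Field k] {g : LieSuperAlg k}

/-- polynomial functions on the variety of module structures -/
def polyAlg [FiniteDimensional k g.carrier] (W : SupMod g) :
    Subalgebra k ({θ // IsStr W θ} → k) :=
  Algebra.adjoin k (Set.range fun i (θ : {θ // IsStr W θ}) =>
    (Module.finBasis k (g.carrier →ₗ[k] W.carrier →ₗ[k] W.carrier)).coord i θ.1)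

theorem polyAlg_noeth [FiniteDimensional k g.carrier] (W : SupMod g) :
    IsNoetherianRing (polyAlg W) := by
  have hfg : (polyAlg W).FG := Subalgebra.fg_def.mpr ⟨_, Set.finite_range _, rfl⟩
  have : Algebra.FiniteType k (polyAlg W) := (polyAlg W).fg_iff_finiteType.mp hfg
  exact Algebra.FiniteType.isNoetherianRing k _

theorem isPolyMap_val [FiniteDimensional k g.carrier] (W : SupMod g) :
    IsPolyMap (polyAlg W) (fun θ : {θ // IsStr W θ} => θ.1) := by
  intro μ
  let b := Module.finBasis k (g.carrier →ₗ[k] W.carrier →ₗ[k] W.carrier)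
  have : (fun θ : {θ // IsStr W θ} => μ θ.1) =
      ∑ i, μ (b i) • (fun θ : {θ // IsStr W θ} => b.coord i θ.1) := by
    ext θ
    conv_lhs => rw [← b.sum_repr θ.1, map_sum]
    simp only [map_smul, Finset.sum_apply, Pi.smul_apply, smul_eq_mul, Module.Basis.coord_apply,
      mul_comm]
  rw [this]
  refine Subalgebra.sum_mem _ fun i _ => Subalgebra.smul_mem _ ?_ _
  exact Algebra.subset_adjoin (Set.mem_range_self (f := fun i (θ : {θ // IsStr W θ}) =>
    (Module.finBasis k (g.carrier →ₗ[k] W.carrier →ₗ[k] W.carrier)).coord i θ.1) i)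

theorem isPolyFam_d0 [FiniteDimensional k g.carrier] (W : SupMod g) (θ₀ : {θ // IsStr W θ}) :
    IsPolyFam (V := C0 W) (V' := C1 W) (polyAlg W) (fun θ => d0 W θ₀ θ) := by
  intro f μ
  obtain ⟨μ', hμ'⟩ := LinearMap.exists_extend μ
  have h : IsPolyMap (polyAlg W)
      (fun θ : {θ // IsStr W θ} => rawR W θ₀.1 f.1 + (- rawL W f.1) θ.1) :=
    (IsPolyMap.const _ _).add ((isPolyMap_val W).comp _)
  have := h μ'
  convert this using 1
  ext θ
  rw [← hμ']
  simp only [LinearMap.comp_apply]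
  congr 1
  show rawR W θ₀.1 f.1 - rawL W f.1 θ.1 = _
  rw [LinearMap.neg_apply, sub_eq_add_neg]

theorem isPolyFam_d1 [FiniteDimensional k g.carrier] (W : SupMod g) (θ₀ : {θ // IsStr W θ}) :
    IsPolyFam (V := C1 W)
      (V' := (g.od →ₗ[k] g.od →ₗ[k] (W.carrier →ₗ[k] W.carrier))) (polyAlg W) (fun θ => d1 W θ₀ θ) := by
  intro c μ
  have h1 := isPolyMap_val W (μ ∘ₗ rawQ W c.1)
  have h2 : (fun _ => μ (rawQ' W θ₀.1 c.1)) ∈ polyAlg W := (polyAlg W).algebraMap_mem _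
  convert (polyAlg W).add_mem h1 h2 using 1
  ext θ
  show μ (rawQ W c.1 θ.1 + rawQ' W θ₀.1 c.1) = μ (rawQ W c.1 θ.1) + μ (rawQ' W θ₀.1 c.1)
  rw [map_add]

theorem open_orbit [CharZero k] [FiniteDimensional k g.carrier] (W : SupMod g)
    (θ₀ : {θ // IsStr W θ}) (hend : IsEndotrivial (mkSup W θ₀)) :
    ∃ p ∈ polyAlg W, p θ₀ ≠ 0 ∧ ∀ θ, p θ ≠ 0 → Iso (mkSup W θ) (mkSup W θ₀) := by
  have hid : (LinearMap.id : W.carrier →ₗ[k] W.carrier) ∈ C0 W :=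
    ⟨fun m hm => hm, fun m hm => hm, fun x _ => rfl⟩
  obtain ⟨h, v, hh, hv, hh0, hv0, hker⟩ := deform (V := C0 W) (V' := C1 W)
    (V'' := (g.od →ₗ[k] g.od →ₗ[k] (W.carrier →ₗ[k] W.carrier))) (polyAlg W) (fun θ => d0 W θ₀ θ)
    (fun θ => d1 W θ₀ θ) (isPolyFam_d0 W θ₀) (isPolyFam_d1 W θ₀) (fun θ f => d1_d0 W θ₀ θ f) θ₀
    (by
      intro c hc
      have hcoc : IsCocycle (mkSup W θ₀) c.1 := by
        refine ⟨⟨c.2.ev, c.2.od_ev, c.2.od_od, ?_⟩, ?_⟩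
        · intro x hx y
          show _ = θ₀.1 x ∘ₗ c.1 y - c.1 y ∘ₗ θ₀.1 x
          rw [θ₀.2.ev x hx]
          exact c.2.equiv x hx y
        · intro x hx y hy
          have := LinearMap.congr_fun (LinearMap.congr_fun hc ⟨x, hx⟩) ⟨y, hy⟩
          rw [d1_apply] at this
          rw [← add_assoc] at this
          exact this
      obtain ⟨f, f0, f1, hf⟩ : ∃ f : W.carrier →ₗ[k] W.carrier, (∀ m ∈ W.ev, f m ∈ W.ev) ∧
          (∀ m ∈ W.od, f m ∈ W.od) ∧ ∀ x, c.1 x = f ∘ₗ θ₀.1 x - θ₀.1 x ∘ₗ f :=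
        rigid _ hend c.1 hcoc
      refine ⟨⟨f, f0, f1, ?_⟩, ?_⟩
      · intro x hx
        have h2 : (0 : W.carrier →ₗ[k] W.carrier) = f ∘ₗ θ₀.1 x - θ₀.1 x ∘ₗ f :=
          (c.2.ev x hx).symm.trans (hf x)
        rw [← θ₀.2.ev x hx]
        exact (sub_eq_zero.mp h2.symm)
      · apply Subtype.ext
        refine LinearMap.ext fun x => ?_
        rw [hf x]
        rfl)
    ⟨LinearMap.id, hid⟩
    (by
      apply Subtype.ext
      refine LinearMap.ext fun x => LinearMap.ext fun m => ?_
      rw [d0_apply]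
      simp)
  have hdet : (fun θ => LinearMap.det (v θ).1) ∈ polyAlg W := by
    apply IsPolyFam.det_mem
    intro w
    exact hv.comp (LinearMap.applyₗ w ∘ₗ (C0 W).subtype)
  refine ⟨h * fun θ => LinearMap.det (v θ).1, Subalgebra.mul_mem _ hh hdet, ?_, ?_⟩
  · simp [hv0, hh0]
  · intro θ hθ
    simp only [Pi.mul_apply, mul_ne_zero_iff] at hθ
    have hk := hker θ hθ.1
    apply Iso.symm
    let e := LinearEquiv.ofIsUnitDet (f := (v θ).1) (v := Module.finBasis k W.carrier)
      (v' := Module.finBasis k W.carrier) (by simpa using hθ.2)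
    refine ⟨e, ?_, (v θ).2.1, (v θ).2.2.1⟩
    intro x
    refine LinearMap.ext fun m => ?_
    have h2 : (v θ).1 (θ₀.1 x m) - θ.1 x ((v θ).1 m) = 0 :=
      LinearMap.congr_fun (LinearMap.congr_fun (congrArg Subtype.val hk) x) m
    exact sub_eq_zero.mp h2

theorem finite_orbits [CharZero k] [FiniteDimensional k g.carrier] (W : SupMod g) :
    ∃ t : Set {θ // IsStr W θ}, t.Finite ∧ ∀ θ, IsEndotrivial (mkSup W θ) →
      ∃ θ' ∈ t, Iso (mkSup W θ) (mkSup W θ') := by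
  have := polyAlg_noeth W
  choose p hp hp0 hpi using fun θ₀ : {θ : {θ // IsStr W θ} // IsEndotrivial (mkSup W θ)} =>
    open_orbit W θ₀.1 θ₀.2
  let q : {θ : {θ // IsStr W θ} // IsEndotrivial (mkSup W θ)} → polyAlg W := fun θ => ⟨p θ, hp θ⟩
  have hfg : (Submodule.span (polyAlg W) (Set.range q)).FG := IsNoetherian.noetherian _
  obtain ⟨s, hs, hspan⟩ := (Submodule.fg_span_iff_fg_span_finset_subset _).mp hfg
  have hs' : ∀ a : s, ∃ θ, q θ = a.1 := fun a => hs a.2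
  choose r hr using hs'
  refine ⟨Set.range fun a => (r a).1, Set.finite_range _, ?_⟩
  intro θ hθ
  by_contra hcon
  push Not at hcon
  have hz : ∀ a : s, a.1.1 θ = 0 := by
    intro a
    by_contra hne
    refine hcon _ ⟨a, rfl⟩ (hpi (r a) θ ?_)
    have : p (r a) = a.1.1 := congrArg Subtype.val (hr a)
    rwa [this]
  have hall : ∀ z ∈ Submodule.span (polyAlg W) (s : Set (polyAlg W)), z.1 θ = 0 := by
    intro z hz'
    induction hz' using Submodule.span_induction with
    | mem x hx => exact hz ⟨x, hx⟩
    | zero => rfl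
    | add x y _ _ hx hy =>
      show x.1 θ + y.1 θ = 0
      rw [hx, hy, add_zero]
    | smul a x _ hx =>
      show a.1 θ * x.1 θ = 0
      rw [hx, mul_zero]
  have hq : q ⟨θ, hθ⟩ ∈ Submodule.span (polyAlg W) (s : Set (polyAlg W)) := by
    rw [← hspan]
    exact Submodule.subset_span ⟨_, rfl⟩
  exact hp0 ⟨θ, hθ⟩ (hall _ hq)

end SupMod

end LieSup

end

noncomputable section

namespace LieSup

namespace SupMod

variable {k : Type} [Field k] {g : LieSuperAlg k}

/-- graded submodules -/
structure IsSub (M : SupMod g) (S : Submodule k M.carrier) : Prop where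
  act : ∀ (x : g.carrier), ∀ m ∈ S, M.ρ x m ∈ S
  pe : ∀ m ∈ S, M.pe m ∈ S

theorem IsSub.po {M : SupMod g} {S : Submodule k M.carrier} (h : IsSub M S) :
    ∀ m ∈ S, M.po m ∈ S := by
  intro m hm
  have : M.po m = m - M.pe m := by rw [eq_sub_iff_add_eq, add_comm, M.pe_add_po]
  rw [this]
  exact S.sub_mem hm (h.pe m hm)

/-- the supermodule structure on a graded submodule -/
def subMod (M : SupMod g) (S : Submodule k M.carrier) (h : IsSub M S) : SupMod g where
  carrier := S
  ev := M.ev.comap S.subtype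
  od := M.od.comap S.subtype
  isCompl := by
    rw [isCompl_iff, Submodule.disjoint_def, codisjoint_iff, Submodule.eq_top_iff']
    refine ⟨fun m h0 h1 => Subtype.ext (M.eq_zero_of_ev_od h0 h1), fun m => ?_⟩
    refine Submodule.mem_sup.mpr ⟨⟨M.pe m, h.pe m m.2⟩, M.pe_mem _, ⟨M.po m, h.po m m.2⟩,
      M.po_mem _, Subtype.ext (M.pe_add_po _)⟩
  ρ := LinearMap.mk₂ k (fun x (m : S) => (⟨M.ρ x m, h.act x m m.2⟩ : S))
    (by intros; apply Subtype.ext; simp) (by intros; apply Subtype.ext; simp)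
    (by intros; apply Subtype.ext; simp) (by intros; apply Subtype.ext; simp)
  ρ_ev_ev := fun x hx m hm => M.ρ_ev_ev x hx m hm
  ρ_ev_od := fun x hx m hm => M.ρ_ev_od x hx m hm
  ρ_od_ev := fun x hx m hm => M.ρ_od_ev x hx m hm
  ρ_od_od := fun x hx m hm => M.ρ_od_od x hx m hm
  ρ_bracket_ev := fun x hx y => by
    refine LinearMap.ext fun m => Subtype.ext ?_
    exact LinearMap.congr_fun (M.ρ_bracket_ev x hx y) m
  ρ_bracket_od := fun x hx y hy => by
    refine LinearMap.ext fun m => Subtype.ext ?_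
    exact LinearMap.congr_fun (M.ρ_bracket_od x hx y hy) m
  completelyReducible := fun N hN => by
    obtain ⟨N', h1, h2⟩ := M.completelyReducible (N.map S.subtype) (by
      rintro x hx _ ⟨m, hm, rfl⟩
      exact ⟨_, hN x hx m hm, rfl⟩)
    refine ⟨N'.comap S.subtype, fun x hx m hm => h1 x hx m hm, ?_⟩
    rw [isCompl_iff, Submodule.disjoint_def, codisjoint_iff, Submodule.eq_top_iff'] at h2 ⊢
    refine ⟨fun m h0 h1 => Subtype.ext (h2.1 m ⟨m, h0, rfl⟩ h1), fun m => ?_⟩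
    obtain ⟨_, ⟨a, ha, rfl⟩, b, hb, hab⟩ := Submodule.mem_sup.mp (h2.2 m)
    refine Submodule.mem_sup.mpr ⟨a, ha, m - a, ?_, by abel⟩
    show (m : M.carrier) - a ∈ N'
    rw [← hab]
    simpa using hb

/-- the quotient supermodule -/
def quotMod (M : SupMod g) (S : Submodule k M.carrier) (h : IsSub M S) : SupMod g where
  carrier := M.carrier ⧸ S
  ev := M.ev.map S.mkQ
  od := M.od.map S.mkQ
  isCompl := by
    rw [isCompl_iff, Submodule.disjoint_def, codisjoint_iff, Submodule.eq_top_iff']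
    refine ⟨?_, fun m => ?_⟩
    · rintro _ ⟨a, ha, rfl⟩ ⟨b, hb, hab⟩
      have h1 : b - a ∈ S := (Submodule.Quotient.eq S).mp hab
      have h2 := h.pe _ h1
      rw [map_sub, M.pe_od hb, M.pe_ev ha, zero_sub, Submodule.neg_mem_iff] at h2
      exact (Submodule.Quotient.mk_eq_zero S).mpr h2
    · obtain ⟨m, rfl⟩ := S.mkQ_surjective m
      refine Submodule.mem_sup.mpr ⟨_, ⟨_, M.pe_mem m, rfl⟩, _, ⟨_, M.po_mem m, rfl⟩, ?_⟩
      rw [← map_add, M.pe_add_po]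
  ρ := LinearMap.mk₂ k (fun x => S.mapQ S (M.ρ x) (fun m hm => h.act x m hm))
    (by
      intro x y m
      obtain ⟨m, rfl⟩ := S.mkQ_surjective m
      simp)
    (by
      intro c x m
      obtain ⟨m, rfl⟩ := S.mkQ_surjective m
      simp)
    (by intros; simp) (by intros; simp)
  ρ_ev_ev := by
    rintro x hx _ ⟨m, hm, rfl⟩
    exact ⟨_, M.ρ_ev_ev x hx m hm, rfl⟩
  ρ_ev_od := by
    rintro x hx _ ⟨m, hm, rfl⟩
    exact ⟨_, M.ρ_ev_od x hx m hm, rfl⟩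
  ρ_od_ev := by
    rintro x hx _ ⟨m, hm, rfl⟩
    exact ⟨_, M.ρ_od_ev x hx m hm, rfl⟩
  ρ_od_od := by
    rintro x hx _ ⟨m, hm, rfl⟩
    exact ⟨_, M.ρ_od_od x hx m hm, rfl⟩
  ρ_bracket_ev := fun x hx y => by
    refine LinearMap.ext fun m => ?_
    obtain ⟨m, rfl⟩ := S.mkQ_surjective m
    exact congrArg S.mkQ (LinearMap.congr_fun (M.ρ_bracket_ev x hx y) m)
  ρ_bracket_od := fun x hx y hy => by
    refine LinearMap.ext fun m => ?_
    obtain ⟨m, rfl⟩ := S.mkQ_surjective m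
    exact congrArg S.mkQ (LinearMap.congr_fun (M.ρ_bracket_od x hx y hy) m)
  completelyReducible := fun N hN => by
    obtain ⟨N', h1, h2⟩ := M.completelyReducible (N.comap S.mkQ) (by
      intro x hx m hm
      exact hN x hx _ hm)
    refine ⟨N'.map S.mkQ, ?_, ?_⟩
    · rintro x hx _ ⟨m, hm, rfl⟩
      exact ⟨_, h1 x hx m hm, rfl⟩
    rw [isCompl_iff, Submodule.disjoint_def, codisjoint_iff, Submodule.eq_top_iff'] at h2 ⊢
    refine ⟨?_, fun m => ?_⟩
    · rintro _ hm ⟨m, hm', rfl⟩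
      rw [h2.1 m hm hm', map_zero]
    · obtain ⟨m, rfl⟩ := S.mkQ_surjective m
      obtain ⟨a, ha, b, hb, hab⟩ := Submodule.mem_sup.mp (h2.2 m)
      refine Submodule.mem_sup.mpr ⟨_, ha, _, ⟨b, hb, rfl⟩, ?_⟩
      rw [← hab, map_add]

/-- even `g₀`-equivariant maps -/
structure IsHom0 (M A : SupMod g) (f : M.carrier →ₗ[k] A.carrier) : Prop where
  ev : ∀ m ∈ M.ev, f m ∈ A.ev
  od : ∀ m ∈ M.od, f m ∈ A.od
  act : ∀ x ∈ g.ev, ∀ m, f (M.ρ x m) = A.ρ x (f m)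

/-- `M` is the direct sum of `A` and `B` over `g₀` -/
def Code (A B M : SupMod g) : Prop :=
  ∃ (α : M.carrier →ₗ[k] A.carrier) (β : M.carrier →ₗ[k] B.carrier),
    IsHom0 M A α ∧ IsHom0 M B β ∧ Function.Bijective (α.prod β)

theorem Code.iso0 {A B M N : SupMod g} (hM : Code A B M) (hN : Code A B N) : Iso0 M N := by
  obtain ⟨α, β, hα, hβ, hM⟩ := hM
  obtain ⟨α', β', hα', hβ', hN⟩ := hN
  let e := LinearEquiv.ofBijective _ hM
  let e' := LinearEquiv.ofBijective _ hN
  have key : ∀ m n, α' n = α m → β' n = β m → e'.symm (e m) = n := by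
    intro m n h1 h2
    rw [LinearEquiv.symm_apply_eq]
    exact Prod.ext h1.symm h2.symm
  have key1 : ∀ m, α' (e'.symm (e m)) = α m := fun m =>
    congrArg Prod.fst (e'.apply_symm_apply (e m))
  have key2 : ∀ m, β' (e'.symm (e m)) = β m := fun m =>
    congrArg Prod.snd (e'.apply_symm_apply (e m))
  have hz : ∀ n, α' n = 0 → β' n = 0 → n = 0 := by
    intro n h1 h2
    apply hN.1
    rw [map_zero]
    exact Prod.ext h1 h2
  refine ⟨e.trans e'.symm, ?_, ?_, ?_⟩
  · intro m hm
    show e'.symm (e m) ∈ N.ev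
    have h1 := key1 m
    have h2 := key2 m
    obtain ⟨a, ha, b, hb, hab⟩ := N.exists_parts (e'.symm (e m))
    rw [hab] at h1 h2 ⊢
    rw [map_add] at h1 h2
    have : b = 0 := by
      apply hz
      · apply A.eq_zero_of_ev_od _ (hα'.od b hb)
        rw [← eq_sub_iff_add_eq'] at h1
        rw [h1]
        exact A.ev.sub_mem (hα.ev m hm) (hα'.ev a ha)
      · apply B.eq_zero_of_ev_od _ (hβ'.od b hb)
        rw [← eq_sub_iff_add_eq'] at h2
        rw [h2]
        exact B.ev.sub_mem (hβ.ev m hm) (hβ'.ev a ha)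
    rw [this, add_zero]
    exact ha
  · intro m hm
    show e'.symm (e m) ∈ N.od
    have h1 := key1 m
    have h2 := key2 m
    obtain ⟨a, ha, b, hb, hab⟩ := N.exists_parts (e'.symm (e m))
    rw [hab] at h1 h2 ⊢
    rw [map_add] at h1 h2
    have : a = 0 := by
      apply hz
      · apply A.eq_zero_of_ev_od (hα'.ev a ha)
        rw [← eq_sub_iff_add_eq] at h1
        rw [h1]
        exact A.od.sub_mem (hα.od m hm) (hα'.od b hb)
      · apply B.eq_zero_of_ev_od (hβ'.ev a ha)
        rw [← eq_sub_iff_add_eq] at h2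
        rw [h2]
        exact B.od.sub_mem (hβ.od m hm) (hβ'.od b hb)
    rw [this, zero_add]
    exact hb
  · intro x hx m
    show e'.symm (e (M.ρ x m)) = N.ρ x (e'.symm (e m))
    apply key
    · rw [hα'.act x hx, hα.act x hx, key1]
    · rw [hβ'.act x hx, hβ.act x hx, key2]

theorem Code.congr {A B A' B' M : SupMod g} (h : Code A B M) (hA : Iso0 A A') (hB : Iso0 B B') :
    Code A' B' M := by
  obtain ⟨α, β, hα, hβ, hM⟩ := h
  obtain ⟨e, e0, e1, ea⟩ := hA
  obtain ⟨f, f0, f1, fa⟩ := hB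
  refine ⟨e.toLinearMap ∘ₗ α, f.toLinearMap ∘ₗ β,
    ⟨fun m hm => e0 _ (hα.ev m hm), fun m hm => e1 _ (hα.od m hm), fun x hx m => ?_⟩,
    ⟨fun m hm => f0 _ (hβ.ev m hm), fun m hm => f1 _ (hβ.od m hm), fun x hx m => ?_⟩, ?_⟩
  · show e (α (M.ρ x m)) = A'.ρ x (e (α m))
    rw [hα.act x hx, ea x hx]
  · show f (β (M.ρ x m)) = B'.ρ x (f (β m))
    rw [hβ.act x hx, fa x hx]
  · exact (e.prodCongr f).bijective.comp hM

theorem pe_act (M : SupMod g) {x : g.carrier} (hx : x ∈ g.ev) (m : M.carrier) :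
    M.pe (M.ρ x m) = M.ρ x (M.pe m) := by
  obtain ⟨a, ha, b, hb, rfl⟩ := M.exists_parts m
  simp [M.pe_ev ha, M.pe_od hb, M.pe_ev (M.ρ_ev_ev x hx a ha), M.pe_od (M.ρ_ev_od x hx b hb)]

theorem po_act (M : SupMod g) {x : g.carrier} (hx : x ∈ g.ev) (m : M.carrier) :
    M.po (M.ρ x m) = M.ρ x (M.po m) := by
  obtain ⟨a, ha, b, hb, rfl⟩ := M.exists_parts m
  simp [M.po_ev ha, M.po_od hb, M.po_ev (M.ρ_ev_ev x hx a ha), M.po_od (M.ρ_ev_od x hx b hb)]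

theorem code_sub_quot (M : SupMod g) (S : Submodule k M.carrier) (h : IsSub M S) :
    Code (subMod M S h) (quotMod M S h) M := by
  obtain ⟨N', hN', hc⟩ := M.completelyReducible S (fun x _ => h.act x)
  let p : M.carrier →ₗ[k] M.carrier := S.subtype ∘ₗ Submodule.projectionOnto S N' hc
  have pS : ∀ m, p m ∈ S := fun m => (Submodule.projectionOnto S N' hc m).2
  have pid : ∀ m ∈ S, p m = m := fun m hm =>
    congrArg Subtype.val (Submodule.projectionOnto_apply_left hc ⟨m, hm⟩)
  have pz : ∀ m ∈ N', p m = 0 := by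
    intro m hm
    simpa [p] using hm
  have pact : ∀ x ∈ g.ev, ∀ m, p (M.ρ x m) = M.ρ x (p m) := by
    intro x hx m
    have hm : m ∈ S ⊔ N' := by rw [hc.sup_eq_top]; trivial
    obtain ⟨a, ha, b, hb, rfl⟩ := Submodule.mem_sup.mp hm
    simp only [map_add, pid a ha, pz b hb, pid _ (h.act x a ha), pz _ (hN' x hx b hb), map_zero]
  let r : M.carrier →ₗ[k] M.carrier := M.pe ∘ₗ p ∘ₗ M.pe + M.po ∘ₗ p ∘ₗ M.po
  have rdef : ∀ m, r m = M.pe (p (M.pe m)) + M.po (p (M.po m)) := fun m => rfl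
  have rS : ∀ m, r m ∈ S := fun m => S.add_mem (h.pe _ (pS _)) (h.po _ (pS _))
  have rid : ∀ m ∈ S, r m = m := by
    intro m hm
    rw [rdef, pid _ (h.pe m hm), pid _ (h.po m hm), M.pe_ev (M.pe_mem m), M.po_od (M.po_mem m),
      M.pe_add_po]
  let r' : M.carrier →ₗ[k] S := r.codRestrict S rS
  refine ⟨r', S.mkQ, ⟨fun m hm => ?_, fun m hm => ?_, fun x hx m => ?_⟩,
    ⟨fun m hm => ⟨m, hm, rfl⟩, fun m hm => ⟨m, hm, rfl⟩, fun x hx m => rfl⟩, ?_, ?_⟩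
  · show r m ∈ M.ev
    rw [rdef, M.po_ev hm, map_zero, map_zero, add_zero]
    exact M.pe_mem _
  · show r m ∈ M.od
    rw [rdef, M.pe_od hm, map_zero, map_zero, zero_add]
    exact M.po_mem _
  · apply Subtype.ext
    show r (M.ρ x m) = M.ρ x (r m)
    rw [rdef, rdef, map_add, M.pe_act hx, M.po_act hx, pact x hx, pact x hx, M.pe_act hx,
      M.po_act hx]
  · rw [← LinearMap.ker_eq_bot, Submodule.eq_bot_iff]
    intro m hm
    have h1 : r m = 0 := congrArg (fun z => ((z.1 : S) : M.carrier)) hm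
    have h2 : S.mkQ m = 0 := congrArg Prod.snd hm
    have h3 : m ∈ S := (Submodule.Quotient.mk_eq_zero S).mp h2
    rw [← rid m h3, h1]
  · rintro ⟨a, b⟩
    obtain ⟨m, rfl⟩ := S.mkQ_surjective b
    obtain ⟨a, ha⟩ := a
    have h4 : a - r m ∈ S := S.sub_mem ha (rS m)
    refine ⟨m + (a - r m), Prod.ext (Subtype.ext ?_) ?_⟩
    · show r (m + (a - r m)) = a
      rw [map_add, rid _ h4]
      abel
    · show S.mkQ (m + (a - r m)) = S.mkQ m
      rw [map_add, (Submodule.Quotient.mk_eq_zero S).mpr h4 |> fun h => (h : S.mkQ _ = 0), add_zero]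

theorem exists_min (M : SupMod g) (hM : ∃ m : M.carrier, m ≠ 0) :
    ∃ (S : Submodule k M.carrier) (h : IsSub M S), IsSimple (subMod M S h) := by
  have hne : {S : Submodule k M.carrier | IsSub M S ∧ S ≠ ⊥}.Nonempty := by
    refine ⟨⊤, ⟨fun _ _ _ => trivial, fun _ _ => trivial⟩, ?_⟩
    obtain ⟨m, hm⟩ := hM
    intro h
    exact hm ((Submodule.mem_bot k).mp (h ▸ Submodule.mem_top))
  obtain ⟨S, ⟨hS, hS0⟩, hmin⟩ :=
    (wellFounded_lt (α := Submodule k M.carrier)).has_min _ hne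
  refine ⟨S, hS, ?_, ?_⟩
  · obtain ⟨m, hm, hm0⟩ := Submodule.exists_mem_ne_zero_of_ne_bot hS0
    exact ⟨(⟨m, hm⟩ : S), fun h => hm0 (congrArg Subtype.val h)⟩
  · have key : ∀ N : Submodule k S,
        (∀ (x : g.carrier) (m : S), m ∈ N → (⟨M.ρ x m, hS.act x m m.2⟩ : S) ∈ N) →
        (∀ m ∈ N, ∃ a ∈ N, ∃ b ∈ N, a.1 ∈ M.ev ∧ b.1 ∈ M.od ∧ a + b = m) → N = ⊥ ∨ N = ⊤ := by
      intro N hN hgr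
      by_cases hN0 : N = ⊥
      · exact Or.inl hN0
      right
      have hsub : IsSub M (N.map S.subtype) := by
        refine ⟨?_, ?_⟩
        · rintro x _ ⟨m, hm, rfl⟩
          exact ⟨_, hN x m hm, rfl⟩
        · rintro _ ⟨m, hm, rfl⟩
          obtain ⟨a, ha, b, hb, h1, h2, hab⟩ := hgr m hm
          refine ⟨a, ha, ?_⟩
          rw [← hab]
          show a.1 = M.pe (a.1 + b.1)
          rw [map_add, M.pe_ev h1, M.pe_od h2, add_zero]
      have hnb : N.map S.subtype ≠ ⊥ := by
        intro h
        apply hN0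
        rw [Submodule.eq_bot_iff] at h ⊢
        intro s hs
        exact Subtype.ext (h s.1 ⟨s, hs, rfl⟩)
      have hle : N.map S.subtype ≤ S := Submodule.map_subtype_le S N
      have heq : N.map S.subtype = S := by
        by_contra hc
        exact hmin _ ⟨hsub, hnb⟩ (lt_of_le_of_ne hle hc)
      rw [Submodule.eq_top_iff']
      intro s
      have hs : (s : S).1 ∈ N.map S.subtype := by rw [heq]; exact s.2
      obtain ⟨t, ht, hts⟩ := hs
      have : t = s := Subtype.ext hts
      exact this ▸ ht
    intro N hN hgr
    refine key N (fun x m hm => hN x m hm) ?_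
    have key2 : ∀ m : (subMod M S hS).carrier, m ∈ N → ∃ a ∈ N, ∃ b ∈ N,
        a ∈ (subMod M S hS).ev ∧ b ∈ (subMod M S hS).od ∧ a + b = m := by
     intro m hm
     have hm2 : m ∈ N ⊓ (subMod M S hS).ev ⊔ N ⊓ (subMod M S hS).od := hgr ▸ hm
     obtain ⟨a, ha, b, hb, hab⟩ := Submodule.mem_sup.mp hm2
     exact ⟨a, ha.1, b, hb.1, ha.2, hb.2, hab⟩
    exact key2

theorem finCover {α : Type} [Finite α] (P : SupMod g → Prop) (C : α → SupMod g → Prop)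
    (h1 : ∀ M, P M → ∃ a, C a M) (h2 : ∀ a M N, C a M → C a N → Iso0 M N) :
    ∃ (ι : Type) (_ : Finite ι) (rep : ι → SupMod g), ∀ M, P M → ∃ i, Iso0 M (rep i) := by
  refine ⟨{a // ∃ M, C a M}, inferInstance, fun a => a.2.choose, fun M hM => ?_⟩
  obtain ⟨a, ha⟩ := h1 M hM
  exact ⟨⟨a, M, ha⟩, h2 a _ _ ha (Exists.choose_spec (⟨M, ha⟩ : ∃ M, C a M))⟩

theorem iso0_of_zero {M N : SupMod g} (hM : ∀ m : M.carrier, m = 0) (hN : ∀ m : N.carrier, m = 0) :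
    Iso0 M N := by
  refine ⟨⟨0, 0, fun m => (hM _).trans (hM m).symm, fun m => (hN _).trans (hN m).symm⟩,
    fun m _ => ?_, fun m _ => ?_, fun x _ m => (hN _).trans (hN _).symm⟩
  · exact N.ev.zero_mem
  · exact N.od.zero_mem

theorem finite_restrictions (n : ℕ)
    (hsimple : ∃ (ι : Type) (_ : Finite ι) (rep : ι → SupMod g),
      ∀ M : SupMod g, IsSimple M → Module.finrank k M.carrier ≤ n → ∃ i, Iso M (rep i))
    (m : ℕ) (hm : m ≤ n) :
    ∃ (ι : Type) (_ : Finite ι) (rep : ι → SupMod g),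
      ∀ M : SupMod g, Module.finrank k M.carrier ≤ m → ∃ i, Iso0 M (rep i) := by
  induction m with
  | zero =>
    refine finCover (α := Unit) _ (fun _ M => ∀ m : M.carrier, m = 0) ?_
      (fun _ M N hM hN => iso0_of_zero hM hN)
    intro M hM
    have := Module.finrank_zero_iff.mp (Nat.le_zero.mp hM)
    exact ⟨(), fun m => Subsingleton.elim _ _⟩
  | succ m ih =>
    obtain ⟨ι, hι, rep, hrep⟩ := ih (by omega)
    obtain ⟨ι', hι', rep', hrep'⟩ := hsimple
    refine finCover (α := Option (ι' × ι)) _ (fun o M => match o with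
      | none => ∀ m : M.carrier, m = 0
      | some (i, j) => Code (rep' i) (rep j) M) ?_ ?_
    · intro M hM
      by_cases h0 : ∀ m : M.carrier, m = 0
      · exact ⟨none, h0⟩
      push Not at h0
      obtain ⟨S, hS, hsimp⟩ := exists_min M h0
      have hadd : Module.finrank k (M.carrier ⧸ S) + Module.finrank k S =
        Module.finrank k M.carrier := Submodule.finrank_quotient_add_finrank S
      have hpos : 0 < Module.finrank k S := by
        obtain ⟨s, hs⟩ := hsimp.1
        exact Module.finrank_pos_iff_exists_ne_zero.mpr ⟨s, hs⟩
      obtain ⟨i, hi⟩ := hrep' _ hsimp (by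
        show Module.finrank k S ≤ n
        omega)
      obtain ⟨j, hj⟩ := hrep (quotMod M S hS) (by
        show Module.finrank k (M.carrier ⧸ S) ≤ m
        omega)
      exact ⟨some (i, j), (code_sub_quot M S hS).congr hi.iso0 hj⟩
    · rintro (_ | ⟨i, j⟩) M N hM hN
      · exact iso0_of_zero hM hN
      · exact Code.iso0 hM hN

theorem main_thm [CharZero k] (hg : g.IsClassical) (n : ℕ)
    (hsimple : ∃ (ι : Type) (_ : Finite ι) (rep : ι → SupMod g),
      ∀ M : SupMod g, IsSimple M → Module.finrank k M.carrier ≤ n → ∃ i, Iso M (rep i)) :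
    ∃ (ι : Type) (_ : Finite ι) (rep : ι → SupMod g),
      ∀ M : SupMod g, IsEndotrivial M → Module.finrank k M.carrier = n →
        ∃ i, Iso M (rep i) := by
  have := hg.1
  obtain ⟨ι, hι, W, hW⟩ := finite_restrictions n hsimple n le_rfl
  choose t ht htt using fun j => finite_orbits (W j)
  have hfin : ∀ j, Finite (t j) := fun j => (ht j)
  refine ⟨Σ j, t j, inferInstance, fun a => mkSup (W a.1) a.2.1, ?_⟩
  intro M hM hMn
  obtain ⟨j, hj⟩ := hW M hMn.le
  obtain ⟨θ, hθ⟩ := exists_mkSup hj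
  obtain ⟨θ', hθ', hiso⟩ := htt j θ (hM.of_iso hθ)
  exact ⟨⟨j, θ', hθ'⟩, hθ.trans hiso⟩

end SupMod

end LieSup

end


open LieSup LieSup.SupMod in
/-- Let `n` be a positive integer and `g = g₀ ⊕ g₁` a
classical Lie superalgebra over an algebraically closed field `k` of
characteristic `0` such that there are finitely many simple modules of
dimension `≤ n` in `F_(g,g₀)` (up to isomorphism).  Then there are only
finitely many isomorphism classes of endotrivial modules in `F_(g,g₀)` of
dimension `n`. -/
theorem finitely_many_endotrivial_modules_of_dim_n
    (k : Type) [Field k] [IsAlgClosed k] [CharZero k]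
    (g : LieSuperAlg k) (hg : g.IsClassical) (n : ℕ) (hn : 0 < n)
    (hsimple : ∃ (ι : Type) (_ : Finite ι) (rep : ι → SupMod g),
      ∀ M : SupMod g, IsSimple M → Module.finrank k M.carrier ≤ n →
        ∃ i, Iso M (rep i)) :
    ∃ (ι : Type) (_ : Finite ι) (rep : ι → SupMod g),
      ∀ M : SupMod g, IsEndotrivial M → Module.finrank k M.carrier = n →
        ∃ i, Iso M (rep i) := by
  exact main_thm hg n hsimple
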